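/- arXiv:alg-geom/9710022 — 5 statements merged into one kernel-verified Lean document; each statement's English description precedes it below -/
import Mathlib

section
/- Fix integers 1 ≤ k < n. Then the origin 0 is an interior point of the polytope Δ(k,n) ⊂ ℝ^{k(n−k)}, and every extreme point of the dual polytope Δ(k,n)* := { y ∈ ℝ^{k(n−k)} : ⟨x,y⟩ ≥ −1 for all x ∈ Δ(k,n) } lies in the integer lattice ℤ^{k(n−k)}; that is, Δ(k,n) is a reflexive polytope. -/
open Finset

/-- The standard basis vector `f_{i,j}` (with `0`-based indices `i,j`) of
`ℝ^{k(n-k)} = (Fin k × Fin (n-k)) → ℝ`. -/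
def basisVec (k n : ℕ) (i j : ℕ) : Fin k × Fin (n - k) → ℝ :=
  fun p => if (p.1 : ℕ) = i ∧ (p.2 : ℕ) = j then 1 else 0

/-- The set of defining vectors `{u_{i,j}} ∪ {v_{i,j}}` of the polytope `Δ(k,n)`
(in `0`-based indexing):
`u_{1,0} = f_{1,1}`;  `u_{i,j} = f_{i,j+1} - f_{i-1,j+1}` for `2 ≤ i ≤ k`, `0 ≤ j ≤ n-k-1`;
`v_{k,n-k} = -f_{k,n-k}`;  `v_{i,j} = f_{i,j+1} - f_{i,j}` for `1 ≤ i ≤ k`, `1 ≤ j ≤ n-k-1`. -/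
def deltaVertices (k n : ℕ) : Set (Fin k × Fin (n - k) → ℝ) :=
  {basisVec k n 0 0} ∪
    {x | ∃ i j : ℕ, 1 ≤ i ∧ i ≤ k - 1 ∧ j ≤ n - k - 1 ∧
      x = basisVec k n i j - basisVec k n (i - 1) j} ∪
    {-(basisVec k n (k - 1) (n - k - 1))} ∪
    {x | ∃ i j : ℕ, i ≤ k - 1 ∧ 1 ≤ j ∧ j ≤ n - k - 1 ∧
      x = basisVec k n i j - basisVec k n i (j - 1)}

/-- The polytope `Δ(k,n) ⊂ ℝ^{k(n-k)}`, the convex hull of the `u_{i,j}` and `v_{i,j}`. -/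
noncomputable def deltaPoly (k n : ℕ) : Set (Fin k × Fin (n - k) → ℝ) :=
  convexHull ℝ (deltaVertices k n)

/-- The dual polytope `Δ(k,n)* = { y : ⟨x,y⟩ ≥ -1 for all x ∈ Δ(k,n) }`. -/
noncomputable def deltaPolyDual (k n : ℕ) : Set (Fin k × Fin (n - k) → ℝ) :=
  {y | ∀ x ∈ deltaPoly k n, (∑ p, x p * y p) ≥ -1}

section Pairing

variable {k n : ℕ}

theorem sum_basisVec_mul (y : Fin k × Fin (n - k) → ℝ) {i j : ℕ} (hi : i < k) (hj : j < n - k) :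
    ∑ p, basisVec k n i j p * y p = y (⟨i, hi⟩, ⟨j, hj⟩) := by
  rw [Finset.sum_eq_single (⟨i, hi⟩, ⟨j, hj⟩)]
  · simp [basisVec]
  · rintro ⟨a, b⟩ - hab
    have : ¬((a : ℕ) = i ∧ (b : ℕ) = j) := by
      rintro ⟨rfl, rfl⟩
      exact hab rfl
    simp [basisVec, this]
  · simp

/-- Pairing with every vertex is at least `-c` iff `y` drops by at most `c` along each
edge of the grid, is at least `-c` at the first corner and at most `c` at the last one. -/
theorem forall_deltaVertices_le_sum_iff (hk : 0 < k) (hm : 0 < n - k)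
    (y : Fin k × Fin (n - k) → ℝ) (c : ℝ) :
    (∀ v ∈ deltaVertices k n, -c ≤ ∑ p, v p * y p) ↔
      -c ≤ y (⟨0, hk⟩, ⟨0, hm⟩) ∧
      y (⟨k - 1, by omega⟩, ⟨n - k - 1, by omega⟩) ≤ c ∧
      (∀ (i j : ℕ) (hi : i + 1 < k) (hj : j < n - k),
        y (⟨i, by omega⟩, ⟨j, hj⟩) - c ≤ y (⟨i + 1, hi⟩, ⟨j, hj⟩)) ∧
      (∀ (i j : ℕ) (hi : i < k) (hj : j + 1 < n - k),
        y (⟨i, hi⟩, ⟨j, by omega⟩) - c ≤ y (⟨i, hi⟩, ⟨j + 1, hj⟩)) := by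
  constructor
  · intro h
    refine ⟨?_, ?_, fun i j hi hj => ?_, fun i j hi hj => ?_⟩
    · have := h (basisVec k n 0 0) (Or.inl (Or.inl (Or.inl rfl)))
      rwa [sum_basisVec_mul y hk hm] at this
    · have := h (-basisVec k n (k - 1) (n - k - 1)) (Or.inl (Or.inr rfl))
      simp only [Pi.neg_apply, neg_mul, Finset.sum_neg_distrib] at this
      rw [sum_basisVec_mul y (by omega) (by omega)] at this
      linarith
    · have := h (basisVec k n (i + 1) j - basisVec k n i j)
        (Or.inl (Or.inl (Or.inr ⟨i + 1, j, by omega, by omega, by omega, rfl⟩)))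
      simp only [Pi.sub_apply, sub_mul, Finset.sum_sub_distrib] at this
      rw [sum_basisVec_mul y hi hj, sum_basisVec_mul y (by omega) hj] at this
      linarith
    · have := h (basisVec k n i (j + 1) - basisVec k n i j)
        (Or.inr ⟨i, j + 1, by omega, by omega, by omega, rfl⟩)
      simp only [Pi.sub_apply, sub_mul, Finset.sum_sub_distrib] at this
      rw [sum_basisVec_mul y hi hj, sum_basisVec_mul y hi (by omega)] at this
      linarith
  · rintro ⟨h0, h1, hu, hv⟩ v (((rfl | ⟨i, j, hi, hi', hj, rfl⟩) | rfl) | ⟨i, j, hi, hj, hj', rfl⟩)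
    · rwa [sum_basisVec_mul y hk hm]
    · obtain ⟨i, rfl⟩ : ∃ l, i = l + 1 := ⟨i - 1, by omega⟩
      simp only [Pi.sub_apply, sub_mul, Finset.sum_sub_distrib, Nat.add_sub_cancel]
      rw [sum_basisVec_mul y (by omega) (by omega), sum_basisVec_mul y (by omega) (by omega)]
      linarith [hu i j (by omega) (by omega)]
    · simp only [Pi.neg_apply, neg_mul, Finset.sum_neg_distrib]
      rw [sum_basisVec_mul y (by omega) (by omega)]
      linarith
    · obtain ⟨j, rfl⟩ : ∃ l, j = l + 1 := ⟨j - 1, by omega⟩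
      simp only [Pi.sub_apply, sub_mul, Finset.sum_sub_distrib, Nat.add_sub_cancel]
      rw [sum_basisVec_mul y (by omega) (by omega), sum_basisVec_mul y (by omega) (by omega)]
      linarith [hv i j (by omega) (by omega)]

theorem abs_le_of_forall_deltaVertices (hk : 0 < k) (hm : 0 < n - k)
    {y : Fin k × Fin (n - k) → ℝ} {c : ℝ}
    (h : ∀ v ∈ deltaVertices k n, -c ≤ ∑ p, v p * y p) :
    0 ≤ c ∧ ∀ p, |y p| ≤ c * n := by
  obtain ⟨h0, h1, hu, hv⟩ := (forall_deltaVertices_le_sum_iff hk hm y c).1 h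
  have lower : ∀ (d i j : ℕ) (hi : i < k) (hj : j < n - k), i + j = d →
      -(c * (d + 1)) ≤ y (⟨i, hi⟩, ⟨j, hj⟩) := by
    intro d
    induction d with
    | zero =>
      intro i j hi hj hd
      obtain ⟨rfl, rfl⟩ : i = 0 ∧ j = 0 := by omega
      simpa using h0
    | succ d ih =>
      intro i j hi hj hd
      push_cast
      rcases i with _ | i
      · rcases j with _ | j
        · omega
        · linarith [hv 0 j hi hj, ih 0 j hi (by omega) (by omega)]
      · linarith [hu i j hi hj, ih i j (by omega) hj (by omega)]
  have upper : ∀ (d i j : ℕ) (hi : i < k) (hj : j < n - k), i + j + d + 2 = n →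
      y (⟨i, hi⟩, ⟨j, hj⟩) ≤ c * (d + 1) := by
    intro d
    induction d with
    | zero =>
      intro i j hi hj hd
      obtain ⟨rfl, rfl⟩ : i = k - 1 ∧ j = n - k - 1 := by omega
      simpa using h1
    | succ d ih =>
      intro i j hi hj hd
      push_cast
      by_cases hi' : i + 1 < k
      · linarith [hu i j hi' hj, ih (i + 1) j hi' hj (by omega)]
      · have hj' : j + 1 < n - k := by omega
        linarith [hv i j hi hj', ih i (j + 1) hi hj' (by omega)]
  have hc : 0 ≤ c := by
    have := lower _ (k - 1) (n - k - 1) (by omega) (by omega) rfl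
    by_contra! hc
    nlinarith [mul_nonneg (neg_nonneg.2 hc.le) (Nat.cast_nonneg (α := ℝ) (k - 1 + (n - k - 1)))]
  refine ⟨hc, ?_⟩
  rintro ⟨⟨i, hi⟩, ⟨j, hj⟩⟩
  rw [abs_le]
  constructor
  · refine le_trans (neg_le_neg (mul_le_mul_of_nonneg_left ?_ hc)) (lower (i + j) i j hi hj rfl)
    exact_mod_cast (by omega : i + j + 1 ≤ n)
  · refine (upper (n - 2 - i - j) i j hi hj (by omega)).trans (mul_le_mul_of_nonneg_left ?_ hc)
    exact_mod_cast (by omega : n - 2 - i - j + 1 ≤ n)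

theorem mem_deltaPolyDual_iff (y : Fin k × Fin (n - k) → ℝ) :
    y ∈ deltaPolyDual k n ↔ ∀ v ∈ deltaVertices k n, -1 ≤ ∑ p, v p * y p := by
  refine ⟨fun h v hv => h v (subset_convexHull ℝ _ hv), fun h x hx => ?_⟩
  have hlin : IsLinearMap ℝ fun x : Fin k × Fin (n - k) → ℝ => ∑ p, x p * y p :=
    ⟨fun a b => by simp [add_mul, Finset.sum_add_distrib],
      fun a b => by simp [mul_assoc, Finset.mul_sum]⟩
  exact convexHull_min h (convex_halfSpace_ge hlin (-1)) hx

theorem finite_deltaVertices (k n : ℕ) : (deltaVertices k n).Finite := by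
  refine (((Set.finite_singleton _).union ?_).union (Set.finite_singleton _)).union ?_
  · refine ((Finset.range k ×ˢ Finset.range (n - k - 1 + 1)).finite_toSet.image
      fun q => basisVec k n q.1 q.2 - basisVec k n (q.1 - 1) q.2).subset ?_
    rintro x ⟨i, j, hi, hi', hj, rfl⟩
    exact ⟨(i, j), by simp; omega, rfl⟩
  · refine ((Finset.range (k - 1 + 1) ×ˢ Finset.range (n - k)).finite_toSet.image
      fun q => basisVec k n q.1 q.2 - basisVec k n q.1 (q.2 - 1)).subset ?_
    rintro x ⟨i, j, hi, hj, hj', rfl⟩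
    exact ⟨(i, j), by simp; omega, rfl⟩

end Pairing

theorem zero_mem_interior_deltaPoly {k n : ℕ} (hk : 0 < k) (hm : 0 < n - k) :
    (0 : Fin k × Fin (n - k) → ℝ) ∈ interior (deltaPoly k n) := by
  set N : ℝ := Fintype.card (Fin k × Fin (n - k)) * n with hN
  have hNpos : 0 < N := by
    have : 0 < n := by omega
    simp only [hN, Fintype.card_prod, Fintype.card_fin]
    positivity
  rw [mem_interior_iff_mem_nhds, Metric.mem_nhds_iff]
  refine ⟨N⁻¹, inv_pos.2 hNpos, fun x hx => ?_⟩
  by_contra hxΔ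
  obtain ⟨f, u, hfx, hf⟩ := geometric_hahn_banach_point_closed (convex_convexHull ℝ _)
    ((finite_deltaVertices k n).isClosed_convexHull ℝ) hxΔ
  set y : Fin k × Fin (n - k) → ℝ := fun p => f fun q => if p = q then 1 else 0
  have hfy (v) : f v = ∑ p, v p * y p := by
    simpa using f.toLinearMap.pi_apply_eq_sum_univ v
  obtain ⟨hc, hb⟩ := abs_le_of_forall_deltaVertices hk hm (y := y) (c := -u) fun v hv => by
    rw [neg_neg, ← hfy]
    exact (hf v (subset_convexHull ℝ _ hv)).le
  have hxp (p) : |x p| ≤ N⁻¹ :=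
    (norm_le_pi_norm x p).trans (mem_ball_zero_iff.1 hx).le
  have hsum : |f x| ≤ -u := calc
    |f x| ≤ ∑ p, |x p * y p| := by
      rw [hfy]
      exact Finset.abs_sum_le_sum_abs _ _
    _ ≤ ∑ _p : Fin k × Fin (n - k), N⁻¹ * (-u * n) := by
      refine Finset.sum_le_sum fun p _ => ?_
      rw [abs_mul]
      exact mul_le_mul (hxp p) (hb p) (abs_nonneg _) (inv_nonneg.2 hNpos.le)
    _ = N⁻¹ * N * -u := by
      rw [Finset.sum_const, nsmul_eq_mul, Finset.card_univ, hN]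
      ring
    _ = -u := by rw [inv_mul_cancel₀ hNpos.ne', one_mul]
  linarith [(abs_le.1 hsum).1]

/-- A monotone map commuting with integer translations and fixing `0` preserves the dual
polytope, whose defining inequalities bound differences of coordinates by integers. -/
theorem comp_mem_deltaPolyDual {k n : ℕ} (hk : 0 < k) (hm : 0 < n - k) {g : ℝ → ℝ}
    (hg : Monotone g) (hg0 : g 0 = 0) (hg1 : ∀ x, g (x - 1) = g x - 1)
    {y : Fin k × Fin (n - k) → ℝ} (hy : y ∈ deltaPolyDual k n) :
    (fun p => g (y p)) ∈ deltaPolyDual k n := by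
  rw [mem_deltaPolyDual_iff, forall_deltaVertices_le_sum_iff hk hm] at hy ⊢
  obtain ⟨h0, h1, hu, hv⟩ := hy
  have hgneg : g (-1) = -1 := by simpa [hg0] using hg1 0
  have hgone : g 1 = 1 := by
    have := hg1 1
    rw [sub_self, hg0] at this
    linarith
  refine ⟨hgneg ▸ hg h0, (hg h1).trans_eq hgone, fun i j hi hj => ?_, fun i j hi hj => ?_⟩
  · rw [← hg1]
    exact hg (hu i j hi hj)
  · rw [← hg1]
    exact hg (hv i j hi hj)

theorem monotone_of_forall_floor {g : ℝ → ℝ} {φ : ℝ → ℝ} (hg : ∀ x, g x = ⌊x⌋ + φ (Int.fract x))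
    (hφ : ∀ s t, 0 ≤ s → s ≤ t → t ≤ 1 → φ s ≤ φ t) (hφ0 : φ 0 = 0) (hφ1 : φ 1 = 1) :
    Monotone g := by
  intro a b hab
  rw [hg, hg]
  rcases (Int.floor_le_floor hab).eq_or_lt with h | h
  · have hfr : Int.fract a ≤ Int.fract b := by
      rw [Int.fract, Int.fract, h]
      linarith
    rw [h]
    linarith [hφ _ _ (Int.fract_nonneg a) hfr (Int.fract_lt_one b).le]
  · have h' : (⌊a⌋ : ℝ) + 1 ≤ ⌊b⌋ := by exact_mod_cast h
    linarith [hφ _ _ (Int.fract_nonneg a) (Int.fract_lt_one a).le le_rfl,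
      hφ _ _ le_rfl (Int.fract_nonneg b) (Int.fract_lt_one b).le]

theorem fract_eq_zero_of_mem_extremePoints {k n : ℕ} (hk : 0 < k) (hm : 0 < n - k)
    {y : Fin k × Fin (n - k) → ℝ} (hy : y ∈ Set.extremePoints ℝ (deltaPolyDual k n))
    (p : Fin k × Fin (n - k)) : Int.fract (y p) = 0 := by
  have key (φ : ℝ → ℝ) (hφ : ∀ s t, 0 ≤ s → s ≤ t → t ≤ 1 → φ s ≤ φ t) (hφ0 : φ 0 = 0)
      (hφ1 : φ 1 = 1) : (fun p => (⌊y p⌋ : ℝ) + φ (Int.fract (y p))) ∈ deltaPolyDual k n := by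
    refine comp_mem_deltaPolyDual hk hm (g := fun x => (⌊x⌋ : ℝ) + φ (Int.fract x))
      (monotone_of_forall_floor (fun _ => rfl) hφ hφ0 hφ1) (by simp [hφ0]) (fun x => ?_) hy.1
    simp only [Int.floor_sub_one, Int.fract_sub_one]
    push_cast
    ring
  have hlow := key (fun t => t ^ 2) (fun s t hs hst _ => by gcongr) (by simp) (by simp)
  have hhigh := key (fun t => 2 * t - t ^ 2) (fun s t _ hst ht => by nlinarith) (by simp)
    (by norm_num)
  have heq := hy.2 hlow hhigh ⟨1 / 2, 1 / 2, by norm_num, by norm_num, by norm_num, by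
    ext q
    simp only [Pi.add_apply, Pi.smul_apply, smul_eq_mul]
    linarith [Int.floor_add_fract (y q)]⟩
  have hp := congrFun heq p
  have hsq : Int.fract (y p) * (1 - Int.fract (y p)) = 0 := by
    linarith [Int.floor_add_fract (y p)]
  exact (mul_eq_zero.1 hsq).resolve_right (sub_pos.2 (Int.fract_lt_one _)).ne'

/-- For `1 ≤ k < n`, the polytope `Δ(k,n)` is reflexive: `0` is an interior point of
`Δ(k,n)` and every extreme point of the dual polytope `Δ(k,n)*` lies in the integer
lattice `ℤ^{k(n-k)}`. -/
theorem stmt_0 (k n : ℕ) (hk : 1 ≤ k) (hkn : k < n) :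
    (0 : Fin k × Fin (n - k) → ℝ) ∈ interior (deltaPoly k n) ∧
      ∀ y ∈ Set.extremePoints ℝ (deltaPolyDual k n),
        ∀ p : Fin k × Fin (n - k), ∃ z : ℤ, y p = (z : ℝ) := by
  have hm : 0 < n - k := by omega
  exact ⟨zero_mem_interior_deltaPoly hk hm, fun y hy p => ⟨⌊y p⌋, by
    linarith [Int.floor_add_fract (y p), fract_eq_zero_of_mem_extremePoints hk hm hy p]⟩⟩
end

section
/- Fix integers 1 ≤ k < n. The set of extreme points of the polytope Δ(k,n) ⊂ ℝ^{k(n−k)} is exactly the set of the defining vectors { u_{i,j} } ∪ { v_{i,j} }, these vectors are pairwise distinct, and hence Δ(k,n) has exactly 2(k−1)(n−k−1) + n vertices. -/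
open Finset

/-- A point of `s` at which some linear functional attains a strict maximum over `s` is an extreme
point of the convex hull of `s`. -/
theorem mem_extremePoints_convexHull_of_strict_max {E : Type*} [AddCommGroup E] [Module ℝ E]
    {s : Set E} {w : E} (hw : w ∈ s) (l : E →ₗ[ℝ] ℝ) (hl : ∀ v ∈ s, v ≠ w → l v < l w) :
    w ∈ Set.extremePoints ℝ (convexHull ℝ s) := by
  have hmax : ∀ y ∈ convexHull ℝ s, y = w ∨ l y < l w := by
    have hconv : Convex ℝ {y | y = w ∨ l y < l w} := by
      rintro x hx y hy a b ha hb hab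
      rcases hx with rfl | hx <;> rcases hy with rfl | hy
      · left
        rw [← add_smul, hab, one_smul]
      · rcases hb.eq_or_lt with rfl | hb
        · left
          obtain rfl : a = 1 := by linarith
          simp
        · right
          obtain rfl : a = 1 - b := by linarith
          simp only [map_add, map_smul, smul_eq_mul]
          nlinarith
      · rcases ha.eq_or_lt with rfl | ha
        · left
          obtain rfl : b = 1 := by linarith
          simp
        · right
          obtain rfl : b = 1 - a := by linarith
          simp only [map_add, map_smul, smul_eq_mul]
          nlinarith
      · right
        obtain rfl : b = 1 - a := by linarith
        simp only [map_add, map_smul, smul_eq_mul]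
        rcases ha.eq_or_lt with rfl | ha
        · simpa using hy
        · nlinarith
    exact convexHull_min (fun v hv => or_iff_not_imp_left.2 (hl v hv)) hconv
  refine ⟨subset_convexHull ℝ s hw, ?_⟩
  rintro x hx y hy ⟨a, b, ha, hb, hab, h⟩
  refine (hmax x hx).resolve_right fun hlt => ?_
  have hy' : l y ≤ l w := by
    rcases hmax y hy with rfl | h
    exacts [le_rfl, h.le]
  have hsum : a * l x + b * l y = l w := by
    simpa using congrArg l h
  obtain rfl : b = 1 - a := by linarith
  nlinarith

/-- The coordinate functional at `(i, j)`. -/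
def coordFunctional (k n : ℕ) (i : Fin k) (j : Fin (n - k)) :
    (Fin k × Fin (n - k) → ℝ) →ₗ[ℝ] ℝ :=
  LinearMap.proj (i, j)

theorem coordFunctional_basisVec (k n : ℕ) (i : Fin k) (j : Fin (n - k)) (a b : ℕ) :
    coordFunctional k n i j (basisVec k n a b) = if (i : ℕ) = a ∧ (j : ℕ) = b then 1 else 0 :=
  rfl

theorem exists_strict_max_deltaVertices {k n : ℕ} (hk : 1 ≤ k) (hkn : k < n)
    {w : Fin k × Fin (n - k) → ℝ} (hw : w ∈ deltaVertices k n) :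
    ∃ l : (Fin k × Fin (n - k) → ℝ) →ₗ[ℝ] ℝ, ∀ v ∈ deltaVertices k n, v ≠ w → l v < l w := by
  rcases hw with ((rfl | ⟨i, j, hi, hik, hj, rfl⟩) | rfl) | ⟨i, j, hi, hj, hjn, rfl⟩
  · refine ⟨coordFunctional k n ⟨0, by omega⟩ ⟨0, by omega⟩, ?_⟩
    rintro v (((rfl | ⟨a, b, ha, hak, hb, rfl⟩) | rfl) | ⟨a, b, ha, hb, hbn, rfl⟩) hne
    · exact absurd rfl hne
    all_goals
      simp only [map_sub, map_neg, coordFunctional_basisVec, and_true, if_true]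
      split_ifs <;> first | (norm_num; done) | omega
  · refine ⟨coordFunctional k n ⟨i, by omega⟩ ⟨j, by omega⟩ -
      coordFunctional k n ⟨i - 1, by omega⟩ ⟨j, by omega⟩, ?_⟩
    rintro v (((rfl | ⟨a, b, ha, hak, hb, rfl⟩) | rfl) | ⟨a, b, ha, hb, hbn, rfl⟩) hne
    rotate_left
    · have hab : ¬ (i = a ∧ j = b) := by
        rintro ⟨rfl, rfl⟩
        exact hne rfl
      simp only [map_sub, LinearMap.sub_apply, coordFunctional_basisVec, and_true, if_true]
      split_ifs <;> first | (norm_num; done) | omega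
    all_goals
      simp only [map_sub, map_neg, LinearMap.sub_apply, coordFunctional_basisVec, and_true, if_true]
      split_ifs <;> first | (norm_num; done) | omega
  · refine ⟨-coordFunctional k n ⟨k - 1, by omega⟩ ⟨n - k - 1, by omega⟩, ?_⟩
    rintro v (((rfl | ⟨a, b, ha, hak, hb, rfl⟩) | rfl) | ⟨a, b, ha, hb, hbn, rfl⟩) hne
    rotate_left 2
    · exact absurd rfl hne
    all_goals
      simp only [map_sub, map_neg, LinearMap.neg_apply, coordFunctional_basisVec, and_true, if_true]
      split_ifs <;> first | (norm_num; done) | omega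
  · refine ⟨coordFunctional k n ⟨i, by omega⟩ ⟨j, by omega⟩ -
      coordFunctional k n ⟨i, by omega⟩ ⟨j - 1, by omega⟩, ?_⟩
    rintro v (((rfl | ⟨a, b, ha, hak, hb, rfl⟩) | rfl) | ⟨a, b, ha, hb, hbn, rfl⟩) hne
    rotate_left 3
    · have hab : ¬ (i = a ∧ j = b) := by
        rintro ⟨rfl, rfl⟩
        exact hne rfl
      simp only [map_sub, LinearMap.sub_apply, coordFunctional_basisVec, true_and, and_true, if_true]
      split_ifs <;> first | (norm_num; done) | omega
    all_goals
      simp only [map_sub, map_neg, LinearMap.sub_apply, coordFunctional_basisVec, true_and, and_true, if_true]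
      split_ifs <;> first | (norm_num; done) | omega

theorem ncard_vertical_differences {k n : ℕ} (hkn : k < n) :
    {x | ∃ i j : ℕ, 1 ≤ i ∧ i ≤ k - 1 ∧ j ≤ n - k - 1 ∧
      x = basisVec k n i j - basisVec k n (i - 1) j}.ncard = (k - 1) * (n - k) := by
  have himage : {x | ∃ i j : ℕ, 1 ≤ i ∧ i ≤ k - 1 ∧ j ≤ n - k - 1 ∧
      x = basisVec k n i j - basisVec k n (i - 1) j} =
      (fun p : ℕ × ℕ => basisVec k n p.1 p.2 - basisVec k n (p.1 - 1) p.2) ''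
        ↑(Icc 1 (k - 1) ×ˢ range (n - k)) := by
    ext x
    simp only [Set.mem_ofPred_eq, Set.mem_image, mem_coe, mem_product, mem_Icc, mem_range,
      Prod.exists]
    constructor
    · rintro ⟨i, j, hi, hik, hj, rfl⟩
      exact ⟨i, j, by omega, rfl⟩
    · rintro ⟨i, j, h, rfl⟩
      exact ⟨i, j, by omega, by omega, by omega, rfl⟩
  rw [himage, Set.InjOn.ncard_image, Set.ncard_coe_finset]
  · simp
  · rintro ⟨i, j⟩ hij ⟨a, b⟩ - h
    simp only [mem_coe, mem_product, mem_Icc, mem_range] at hij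
    have h₁ := congrFun h (⟨i, by omega⟩, ⟨j, by omega⟩)
    simp only [Pi.sub_apply, basisVec, and_true, if_true] at h₁
    rw [Prod.mk.injEq]
    split_ifs at h₁ <;> first | omega | norm_num at h₁

theorem ncard_horizontal_differences {k n : ℕ} (hk : 1 ≤ k) :
    {x | ∃ i j : ℕ, i ≤ k - 1 ∧ 1 ≤ j ∧ j ≤ n - k - 1 ∧
      x = basisVec k n i j - basisVec k n i (j - 1)}.ncard = k * (n - k - 1) := by
  have himage : {x | ∃ i j : ℕ, i ≤ k - 1 ∧ 1 ≤ j ∧ j ≤ n - k - 1 ∧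
      x = basisVec k n i j - basisVec k n i (j - 1)} =
      (fun p : ℕ × ℕ => basisVec k n p.1 p.2 - basisVec k n p.1 (p.2 - 1)) ''
        ↑(range k ×ˢ Icc 1 (n - k - 1)) := by
    ext x
    simp only [Set.mem_ofPred_eq, Set.mem_image, mem_coe, mem_product, mem_Icc, mem_range,
      Prod.exists]
    constructor
    · rintro ⟨i, j, hi, hj, hjn, rfl⟩
      exact ⟨i, j, by omega, rfl⟩
    · rintro ⟨i, j, h, rfl⟩
      exact ⟨i, j, by omega, by omega, by omega, rfl⟩
  rw [himage, Set.InjOn.ncard_image, Set.ncard_coe_finset]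
  · simp
  · rintro ⟨i, j⟩ hij ⟨a, b⟩ - h
    simp only [mem_coe, mem_product, mem_Icc, mem_range] at hij
    have h₁ := congrFun h (⟨i, by omega⟩, ⟨j, by omega⟩)
    simp only [Pi.sub_apply, basisVec, true_and, and_true, if_true] at h₁
    rw [Prod.mk.injEq]
    split_ifs at h₁ <;> first | omega | norm_num at h₁

theorem finite_vertical_differences (k n : ℕ) :
    {x | ∃ i j : ℕ, 1 ≤ i ∧ i ≤ k - 1 ∧ j ≤ n - k - 1 ∧
      x = basisVec k n i j - basisVec k n (i - 1) j}.Finite := by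
  refine ((Finset.finite_toSet (range k ×ˢ range (n - k - 1 + 1))).image
    (fun p : ℕ × ℕ => basisVec k n p.1 p.2 - basisVec k n (p.1 - 1) p.2)).subset ?_
  rintro x ⟨i, j, hi, hik, hj, rfl⟩
  refine ⟨(i, j), ?_, rfl⟩
  simp only [mem_coe, mem_product, mem_range]
  omega

theorem finite_horizontal_differences (k n : ℕ) :
    {x | ∃ i j : ℕ, i ≤ k - 1 ∧ 1 ≤ j ∧ j ≤ n - k - 1 ∧
      x = basisVec k n i j - basisVec k n i (j - 1)}.Finite := by
  refine ((Finset.finite_toSet (range (k - 1 + 1) ×ˢ range (n - k))).image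
    (fun p : ℕ × ℕ => basisVec k n p.1 p.2 - basisVec k n p.1 (p.2 - 1))).subset ?_
  rintro x ⟨i, j, hi, hj, hjn, rfl⟩
  refine ⟨(i, j), ?_, rfl⟩
  simp only [mem_coe, mem_product, mem_range]
  omega

theorem ncard_deltaVertices {k n : ℕ} (hk : 1 ≤ k) (hkn : k < n) :
    (deltaVertices k n).ncard = 2 * (k - 1) * (n - k - 1) + n := by
  have hfin := finite_vertical_differences k n
  unfold deltaVertices
  rw [Set.ncard_union_eq _ (((Set.finite_singleton _).union hfin).union (Set.finite_singleton _))
      (finite_horizontal_differences k n),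
    Set.ncard_union_eq _ ((Set.finite_singleton _).union hfin) (Set.finite_singleton _),
    Set.ncard_union_eq _ (Set.finite_singleton _) hfin,
    ncard_vertical_differences hkn, ncard_horizontal_differences hk, Set.ncard_singleton,
    Set.ncard_singleton]
  · obtain ⟨a, rfl⟩ : ∃ a, k = a + 1 := ⟨k - 1, by omega⟩
    obtain ⟨b, rfl⟩ : ∃ b, n = a + 1 + (b + 1) := ⟨n - (a + 1) - 1, by omega⟩
    simp only [Nat.add_sub_cancel, Nat.add_sub_cancel_left]
    ring
  · rw [Set.disjoint_left]
    rintro x rfl ⟨i, j, hi, hik, hj, h⟩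
    have h₁ := congrFun h (⟨i, by omega⟩, ⟨j, by omega⟩)
    simp only [Pi.sub_apply, basisVec, and_true, if_true] at h₁
    split_ifs at h₁ <;> first | omega | norm_num at h₁
  · rw [Set.disjoint_left]
    rintro x (rfl | ⟨i, j, hi, hik, hj, rfl⟩) h
    · have h₁ := congrFun h (⟨0, by omega⟩, ⟨0, by omega⟩)
      simp only [Pi.neg_apply, basisVec, and_true, if_true] at h₁
      split_ifs at h₁ <;> first | omega | norm_num at h₁
    · have h₁ := congrFun h (⟨i, by omega⟩, ⟨j, by omega⟩)
      simp only [Pi.sub_apply, Pi.neg_apply, basisVec, and_true, if_true] at h₁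
      split_ifs at h₁ <;> first | omega | norm_num at h₁
  · rw [Set.disjoint_left]
    rintro x ((rfl | ⟨a, b, ha, hak, hb, rfl⟩) | rfl) ⟨i, j, hi, hj, hjn, h⟩
    · have h₁ := congrFun h (⟨i, by omega⟩, ⟨j, by omega⟩)
      simp only [Pi.sub_apply, basisVec, true_and, and_true, if_true] at h₁
      split_ifs at h₁ <;> first | omega | norm_num at h₁
    · have h₁ := congrFun h (⟨i, by omega⟩, ⟨j, by omega⟩)
      have h₂ := congrFun h (⟨i, by omega⟩, ⟨j - 1, by omega⟩)
      simp only [Pi.sub_apply, basisVec, true_and, and_true, if_true] at h₁ h₂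
      split_ifs at h₁ h₂ <;> first | omega | (norm_num at h₁; done) | norm_num at h₂
    · have h₁ := congrFun h (⟨i, by omega⟩, ⟨j, by omega⟩)
      simp only [Pi.sub_apply, Pi.neg_apply, basisVec, true_and, and_true, if_true] at h₁
      split_ifs at h₁ <;> first | omega | norm_num at h₁

/-- For `1 ≤ k < n`, the set of extreme points of `Δ(k,n)` is exactly the set of defining
vectors `{u_{i,j}} ∪ {v_{i,j}}`, and these vectors are pairwise distinct, so that `Δ(k,n)`
has exactly `2(k-1)(n-k-1) + n` vertices (note that the total number of index labels of
the `u_{i,j}` and `v_{i,j}` is `2(k-1)(n-k-1) + n`, so the cardinality statement encodes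
their pairwise distinctness). -/
theorem stmt_2 (k n : ℕ) (hk : 1 ≤ k) (hkn : k < n) :
    Set.extremePoints ℝ (deltaPoly k n) = deltaVertices k n ∧
      (deltaVertices k n).ncard = 2 * (k - 1) * (n - k - 1) + n := by
  refine ⟨Set.Subset.antisymm extremePoints_convexHull_subset fun w hw => ?_,
    ncard_deltaVertices hk hkn⟩
  obtain ⟨l, hl⟩ := exists_strict_max_deltaVertices hk hkn hw
  exact mem_extremePoints_convexHull_of_strict_max hw l hl
end

section
/- Fix integers 1 ≤ k < n. In the polynomial ring ℂ[z_a : a ∈ A(k,n)], the ideal I(k,n) generated by the binomials z_a·z_{a'} − z_{min(a,a')}·z_{max(a,a')}, where (a,a') runs over all pairs of incomparable elements of A(k,n), is a prime ideal. (Thus these quadratic binomial equations define the irreducible toric variety P(k,n) ⊂ P^{binomial(n,k)−1}.) -/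
open MvPolynomial

/-- The index set `A(k,n)` of strictly increasing `k`-tuples of elements of `{1,…,n}`
(realized as strictly monotone maps `Fin k → Fin n`), with the componentwise
partial order inherited from `Fin k → Fin n`. -/
def AIdx (k n : ℕ) : Type :=
  {a : Fin k → Fin n // StrictMono a}

/-- The set of Hibi binomials `z_a·z_{a'} - z_{min(a,a')}·z_{max(a,a')}` in
`ℂ[z_a : a ∈ A(k,n)]`, where `(a,a')` runs over pairs of incomparable elements
of `A(k,n)` and `min`, `max` denote the componentwise minimum and maximum
(which are again strictly increasing). -/
def hibiGens (k n : ℕ) : Set (MvPolynomial (AIdx k n) ℂ) :=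
  {f | ∃ a a' m M : AIdx k n,
    ¬ a.1 ≤ a'.1 ∧ ¬ a'.1 ≤ a.1 ∧
    (∀ i, m.1 i = min (a.1 i) (a'.1 i)) ∧
    (∀ i, M.1 i = max (a.1 i) (a'.1 i)) ∧
    f = X a * X a' - X m * X M}

/-- The Hibi ideal `I(k,n)`, generated by the binomials
`z_a·z_{a'} - z_{min(a,a')}·z_{max(a,a')}` over incomparable pairs `(a,a')`. -/
noncomputable def hibiIdeal (k n : ℕ) : Ideal (MvPolynomial (AIdx k n) ℂ) :=
  Ideal.span (hibiGens k n)

namespace AIdx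

variable {k n : ℕ}

/-- The componentwise minimum of two increasing tuples. -/
def inf (a b : AIdx k n) : AIdx k n :=
  ⟨fun i => min (a.1 i) (b.1 i), fun _ _ h => min_lt_min (a.2 h) (b.2 h)⟩

/-- The componentwise maximum of two increasing tuples. -/
def sup (a b : AIdx k n) : AIdx k n :=
  ⟨fun i => max (a.1 i) (b.1 i), fun _ _ h => max_lt_max (a.2 h) (b.2 h)⟩

/-- The exponent vector of the monomial `∏ i, x_{i, a_i}`. -/
noncomputable def weight (a : AIdx k n) : Fin k × Fin n →₀ ℕ :=
  ∑ i, Finsupp.single (i, a.1 i) 1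

theorem weight_apply (a : AIdx k n) (i : Fin k) (j : Fin n) :
    a.weight (i, j) = if a.1 i = j then 1 else 0 := by
  rw [weight, Finsupp.finsetSum_apply, Finset.sum_eq_single i]
  · simp [Finsupp.single_apply]
  · intro b _ hb
    simp [hb]
  · simp

theorem weight_inf_add_weight_sup (a b : AIdx k n) :
    (a.inf b).weight + (a.sup b).weight = a.weight + b.weight := by
  simp only [weight, ← Finset.sum_add_distrib]
  refine Finset.sum_congr rfl fun i _ => ?_
  rcases le_total (a.1 i) (b.1 i) with h | h
  · simp [inf, sup, h]
  · simp [inf, sup, h, add_comm]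

theorem exists_mem_of_weight_sum_apply_ne_zero {s : Multiset (AIdx k n)} {i : Fin k} {j : Fin n}
    (h : (s.map weight).sum (i, j) ≠ 0) : ∃ a ∈ s, a.1 i = j := by
  induction s using Multiset.induction_on with
  | empty => simp at h
  | cons a s ih =>
    by_cases ha : a.1 i = j
    · exact ⟨a, Multiset.mem_cons_self a s, ha⟩
    · obtain ⟨b, hb, hj⟩ := ih (by simpa [weight_apply, ha] using h)
      exact ⟨b, Multiset.mem_cons_of_mem hb, hj⟩

theorem weight_sum_cons_apply_ne_zero (a : AIdx k n) (s : Multiset (AIdx k n)) (i : Fin k) :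
    ((a ::ₘ s).map weight).sum (i, a.1 i) ≠ 0 := by
  simp [weight_apply]

theorem le_of_weight_sum_eq {a b : AIdx k n} {s t : Multiset (AIdx k n)}
    (h : ((a ::ₘ s).map weight).sum = ((b ::ₘ t).map weight).sum) (ht : ∀ c ∈ t, b.1 ≤ c.1) :
    b.1 ≤ a.1 := by
  intro i
  have h0 := weight_sum_cons_apply_ne_zero a s i
  rw [h] at h0
  obtain ⟨c, hc, hci⟩ := exists_mem_of_weight_sum_apply_ne_zero h0
  rw [← hci]
  rcases Multiset.mem_cons.1 hc with rfl | hc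
  · exact le_rfl
  · exact ht c hc i

end AIdx

section HibiQuotient

variable {k n : ℕ}

theorem hibi_mk_mul (a b : AIdx k n) :
    Ideal.Quotient.mk (hibiIdeal k n) (X a * X b) =
      Ideal.Quotient.mk (hibiIdeal k n) (X (a.inf b) * X (a.sup b)) := by
  by_cases h : a.1 ≤ b.1
  · have h1 : a.inf b = a := Subtype.ext (funext fun i => min_eq_left (h i))
    have h2 : a.sup b = b := Subtype.ext (funext fun i => max_eq_right (h i))
    rw [h1, h2]
  by_cases h' : b.1 ≤ a.1
  · have h1 : a.inf b = b := Subtype.ext (funext fun i => min_eq_right (h' i))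
    have h2 : a.sup b = a := Subtype.ext (funext fun i => max_eq_left (h' i))
    rw [h1, h2, mul_comm]
  · exact Ideal.Quotient.eq.2 (Ideal.subset_span
      ⟨a, b, a.inf b, a.sup b, h, h', fun _ => rfl, fun _ => rfl, rfl⟩)

/-- Modulo the Hibi ideal, the componentwise minimum of the factors splits off a monomial. -/
theorem hibi_exists_least_factor (a : AIdx k n) (s : Multiset (AIdx k n)) :
    ∃ (b : AIdx k n) (t : Multiset (AIdx k n)), t.card = s.card ∧
      Ideal.Quotient.mk (hibiIdeal k n) ((a ::ₘ s).map X).prod =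
        Ideal.Quotient.mk (hibiIdeal k n) ((b ::ₘ t).map X).prod ∧
      ((a ::ₘ s).map AIdx.weight).sum = ((b ::ₘ t).map AIdx.weight).sum ∧
      ∀ c ∈ t, b.1 ≤ c.1 := by
  induction s using Multiset.induction_on with
  | empty => exact ⟨a, 0, rfl, rfl, rfl, by simp⟩
  | cons c s ih =>
    obtain ⟨b, t, hcard, hq, hw, hb⟩ := ih
    refine ⟨c.inf b, c.sup b ::ₘ t, by simp [hcard], ?_, ?_, ?_⟩
    · rw [Multiset.cons_swap, Multiset.map_cons, Multiset.prod_cons, map_mul, hq]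
      have := hibi_mk_mul c b
      simp only [Multiset.map_cons, Multiset.prod_cons, map_mul, ← mul_assoc] at this ⊢
      rw [this]
    · rw [Multiset.cons_swap, Multiset.map_cons, Multiset.sum_cons, hw]
      have := AIdx.weight_inf_add_weight_sup c b
      simp only [Multiset.map_cons, Multiset.sum_cons, ← add_assoc] at this ⊢
      rw [this]
    · intro d hd i
      rcases Multiset.mem_cons.1 hd with rfl | hd
      · exact min_le_max
      · exact (min_le_right _ _).trans (hb d hd i)

theorem hibi_mk_prod_eq_of_weight_sum_eq (hk : 1 ≤ k) (s t : Multiset (AIdx k n))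
    (h : (s.map AIdx.weight).sum = (t.map AIdx.weight).sum) :
    Ideal.Quotient.mk (hibiIdeal k n) (s.map X).prod =
      Ideal.Quotient.mk (hibiIdeal k n) (t.map X).prod := by
  induction hd : s.card generalizing s t with
  | zero =>
    obtain rfl := Multiset.card_eq_zero.1 hd
    rcases t.empty_or_exists_mem with rfl | ⟨b, hb⟩
    · rfl
    · obtain ⟨t, rfl⟩ := Multiset.exists_cons_of_mem hb
      exact absurd (by rw [← h]; simp) (AIdx.weight_sum_cons_apply_ne_zero b t ⟨0, hk⟩)
  | succ d ih =>
    obtain ⟨a, ha⟩ := Multiset.card_pos_iff_exists_mem.1 (by omega : 0 < s.card)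
    obtain ⟨s, rfl⟩ := Multiset.exists_cons_of_mem ha
    rcases t.empty_or_exists_mem with rfl | ⟨b, hb⟩
    · exact absurd (by rw [h]; simp) (AIdx.weight_sum_cons_apply_ne_zero a s ⟨0, hk⟩)
    obtain ⟨t, rfl⟩ := Multiset.exists_cons_of_mem hb
    obtain ⟨a', s', hcard, hqs, hws, hs⟩ := hibi_exists_least_factor a s
    obtain ⟨b', t', -, hqt, hwt, ht⟩ := hibi_exists_least_factor b t
    have hw : ((a' ::ₘ s').map AIdx.weight).sum = ((b' ::ₘ t').map AIdx.weight).sum := by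
      rw [← hws, h, hwt]
    obtain rfl : a' = b' := Subtype.ext
      (le_antisymm (AIdx.le_of_weight_sum_eq hw.symm hs) (AIdx.le_of_weight_sum_eq hw ht))
    have hst := ih s' t' (by simpa using hw) (by simpa [hcard] using hd)
    rw [hqs, hqt, Multiset.map_cons, Multiset.map_cons, Multiset.prod_cons, Multiset.prod_cons,
      map_mul, map_mul, hst]

end HibiQuotient

/-- The monomial parametrization `z_a ↦ ∏ i, x_{i, a_i}` of the toric variety. -/
noncomputable def hibiParam (k n : ℕ) :
    MvPolynomial (AIdx k n) ℂ →ₐ[ℂ] MvPolynomial (Fin k × Fin n) ℂ :=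
  aeval fun a => monomial a.weight 1

theorem monomial_eq_smul_prod_toMultiset {σ R : Type*} [CommSemiring R] (m : σ →₀ ℕ) (c : R) :
    monomial m c = c • ((Finsupp.toMultiset m).map X).prod := by
  rw [Finsupp.toMultiset_map, Finsupp.prod_toMultiset, monomial_eq, smul_eq_C_mul,
    Finsupp.prod_mapDomain_index pow_zero pow_add]

theorem hibiParam_monomial {k n : ℕ} (m : AIdx k n →₀ ℕ) (c : ℂ) :
    hibiParam k n (monomial m c) =
      monomial ((Finsupp.toMultiset m).map AIdx.weight).sum c := by
  have h (s : Multiset (AIdx k n)) :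
      hibiParam k n (s.map X).prod = monomial (s.map AIdx.weight).sum 1 := by
    induction s using Multiset.induction_on with
    | empty => simp
    | cons a s ih =>
      rw [Multiset.map_cons, Multiset.prod_cons, map_mul, ih, Multiset.map_cons,
        Multiset.sum_cons, hibiParam, aeval_X, monomial_mul, one_mul]
  rw [monomial_eq_smul_prod_toMultiset, map_smul, h, smul_monomial, smul_eq_mul, mul_one]

theorem hibiIdeal_le_ker_hibiParam (k n : ℕ) :
    hibiIdeal k n ≤ RingHom.ker (hibiParam k n) := by
  refine Ideal.span_le.2 ?_
  rintro _ ⟨a, b, m, M, -, -, hm, hM, rfl⟩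
  obtain rfl : m = a.inf b := Subtype.ext (funext hm)
  obtain rfl : M = a.sup b := Subtype.ext (funext hM)
  simp [hibiParam, monomial_mul, AIdx.weight_inf_add_weight_sup]

theorem ker_hibiParam_le_hibiIdeal {k : ℕ} (n : ℕ) (hk : 1 ≤ k) :
    RingHom.ker (hibiParam k n) ≤ hibiIdeal k n := by
  let w : (AIdx k n →₀ ℕ) → (Fin k × Fin n →₀ ℕ) := fun m =>
    ((Finsupp.toMultiset m).map AIdx.weight).sum
  let q : (AIdx k n →₀ ℕ) → MvPolynomial (AIdx k n) ℂ ⧸ hibiIdeal k n := fun m =>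
    Ideal.Quotient.mk _ ((Finsupp.toMultiset m).map X).prod
  have hq : Function.FactorsThrough q w := fun m m' h =>
    hibi_mk_prod_eq_of_weight_sum_eq hk _ _ h
  let L : MvPolynomial (Fin k × Fin n) ℂ →ₗ[ℂ] MvPolynomial (AIdx k n) ℂ ⧸ hibiIdeal k n :=
    (basisMonomials (Fin k × Fin n) ℂ).constr ℂ (Function.extend w q 0)
  have hL (e : Fin k × Fin n →₀ ℕ) : L (monomial e 1) = Function.extend w q 0 e := by
    simpa using (basisMonomials (Fin k × Fin n) ℂ).constr_basis ℂ (Function.extend w q 0) e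
  have hcomp : L ∘ₗ (hibiParam k n).toLinearMap =
      (Ideal.Quotient.mkₐ ℂ (hibiIdeal k n)).toLinearMap := by
    refine (basisMonomials (AIdx k n) ℂ).ext fun m => ?_
    simp only [coe_basisMonomials, LinearMap.comp_apply, AlgHom.toLinearMap_apply,
      hibiParam_monomial]
    rw [hL, hq.extend_apply, monomial_eq_smul_prod_toMultiset, one_smul]
    rfl
  intro f hf
  refine Ideal.Quotient.eq_zero_iff_mem.1 ?_
  have hf' := LinearMap.congr_fun hcomp f
  rw [LinearMap.comp_apply, AlgHom.toLinearMap_apply, show hibiParam k n f = 0 from hf,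
    map_zero] at hf'
  exact hf'.symm

/-- For `1 ≤ k < n`, the Hibi ideal `I(k,n)` is prime: the quadratic binomial equations
cut out the irreducible toric variety `P(k,n) ⊂ P^{C(n,k)-1}`. -/
theorem stmt_3 (k n : ℕ) (hk : 1 ≤ k) (hkn : k < n) :
    (hibiIdeal k n).IsPrime := by
  rw [le_antisymm (hibiIdeal_le_ker_hibiParam k n) (ker_hibiParam_le_hibiIdeal n hk)]
  exact RingHom.ker_isPrime _
end

section
/- Fix integers 1 ≤ k < n. There exists a finitely generated ℂ[t]-algebra S which is flat as a ℂ[t]-module, such that S/(t)S is isomorphic as a ℂ-algebra to the Hibi ring H(k,n) = ℂ[z_a : a ∈ A(k,n)]/I(k,n), and for every nonzero complex number c, S/(t−c)S is isomorphic as a ℂ-algebra to the Plücker algebra R(k,n). (That is, the toric variety P(k,n) defined by the Hibi binomials is a flat degeneration of the Plücker-embedded Grassmannian G(k,n).) -/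
open MvPolynomial

/-- The Hibi ring `H(k,n) = ℂ[z_a : a ∈ A(k,n)] / I(k,n)`, the homogeneous coordinate
ring of the toric variety `P(k,n)`. -/
noncomputable def HibiRing (k n : ℕ) : Type :=
  MvPolynomial (AIdx k n) ℂ ⧸ hibiIdeal k n

noncomputable instance (k n : ℕ) : CommRing (HibiRing k n) :=
  inferInstanceAs (CommRing (MvPolynomial (AIdx k n) ℂ ⧸ hibiIdeal k n))

noncomputable instance (k n : ℕ) : Algebra ℂ (HibiRing k n) :=
  inferInstanceAs (Algebra ℂ (MvPolynomial (AIdx k n) ℂ ⧸ hibiIdeal k n))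

/-- The Plücker coordinate `p_a`, the `k×k` minor `det(x_{i,a_j})` of the generic
`k×n` matrix of variables. -/
noncomputable def plueckerMinor (k n : ℕ) (a : AIdx k n) :
    MvPolynomial (Fin k × Fin n) ℂ :=
  (Matrix.of fun i j : Fin k => X (i, a.1 j)).det

/-- The Plücker algebra `R(k,n) ⊆ ℂ[x_{i,j}]`, the subalgebra generated by all the
maximal minors `p_a`; it is the homogeneous coordinate ring of the Plücker-embedded
Grassmannian `G(k,n)`. -/
noncomputable def pluckerAlg (k n : ℕ) : Subalgebra ℂ (MvPolynomial (Fin k × Fin n) ℂ) :=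
  Algebra.adjoin ℂ (Set.range (plueckerMinor k n))

/-- A flat family over the affine line `Spec ℂ[t]` with special fiber the Hibi ring
`H(k,n)` and all other fibers the Plücker algebra `R(k,n)`. -/
structure FlatDegeneration (k n : ℕ) where
  S : Type
  [commRing : CommRing S]
  [algC : Algebra ℂ S]
  [algP : Algebra (Polynomial ℂ) S]
  [tower : IsScalarTower ℂ (Polynomial ℂ) S]
  finiteType : Algebra.FiniteType (Polynomial ℂ) S
  flat : Module.Flat (Polynomial ℂ) S
  specialFiber :
    (S ⧸ Ideal.span {algebraMap (Polynomial ℂ) S Polynomial.X}) ≃ₐ[ℂ] HibiRing k n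
  genericFiber : ∀ c : ℂ, c ≠ 0 →
    Nonempty ((S ⧸ Ideal.span {algebraMap (Polynomial ℂ) S
      (Polynomial.X - Polynomial.C c)}) ≃ₐ[ℂ] pluckerAlg k n)

namespace AlternatingMap

variable {R M N ι : Type*} [CommRing R] [AddCommGroup M] [Module R M]
  [AddCommGroup N] [Module R N]

/-- The alternating map obtained by fixing the arguments of `f` outside of `p`. -/
def restrictDom (f : M [⋀^ι]→ₗ[R] N) (p : ι → Prop) [DecidablePred p] (z : ι → M) :
    M [⋀^{i // p i}]→ₗ[R] N :=
  { f.toMultilinearMap.domDomRestrict p fun i => z i with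
    map_eq_zero_of_eq' := fun x i j hij hne => by
      refine f.map_eq_zero_of_eq (i := i) (j := j) _ ?_ fun h => hne (Subtype.ext h)
      simp [i.2, j.2, hij] }

theorem restrictDom_apply (f : M [⋀^ι]→ₗ[R] N) (p : ι → Prop) [DecidablePred p] (z : ι → M)
    (x : {i // p i} → M) :
    f.restrictDom p z x = f fun j => if h : p j then x ⟨j, h⟩ else z j := rfl

end AlternatingMap

/-- The tuple `A` with its entries at the positions in `p` replaced by `c`. -/
def replaceOn {ι α : Type*} (A : ι → α) (p : ι → Prop) [DecidablePred p] (c : {i // p i} → α) :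
    ι → α :=
  fun j => if h : p j then c ⟨j, h⟩ else A j

open scoped TensorProduct in
/-- The exchange relation for a product of two alternating maps: if more vectors are permuted
than the rank of the module, then the product is minus the sum of the other shuffles. -/
theorem AlternatingMap.exchange_mem {R M ι α : Type*} [CommRing R] [IsDomain R] [AddCommGroup M]
    [Module R M] [Module.Finite R M] [Module.Free R M] [Fintype ι] [DecidableEq ι]
    (f g : M [⋀^ι]→ₗ[R] R) (p q : ι → Prop) [DecidablePred p] [DecidablePred q]
    (hcard : Module.finrank R M < Fintype.card {i // p i} + Fintype.card {i // q i})
    (v : α → M) (A B : ι → α) (W : AddSubgroup R)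
    (hW : ∀ τ : Equiv.Perm ({i // p i} ⊕ {i // q i}),
      τ ∉ (Equiv.Perm.sumCongrHom {i // p i} {i // q i}).range →
      f (v ∘ replaceOn A p fun i => Sum.elim (fun i => A i.1) (fun i => B i.1) (τ (Sum.inl i))) *
        g (v ∘ replaceOn B q fun i =>
          Sum.elim (fun i => A i.1) (fun i => B i.1) (τ (Sum.inr i))) ∈ W) :
    f (v ∘ A) * g (v ∘ B) ∈ W := by
  classical
  set c : {i // p i} ⊕ {i // q i} → α := Sum.elim (fun i => A i.1) (fun i => B i.1) with hc
  set F := f.restrictDom p (v ∘ A)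
  set G := g.restrictDom q (v ∘ B)
  have key : ∀ τ : Equiv.Perm ({i // p i} ⊕ {i // q i}),
      LinearMap.mul' R R (AlternatingMap.domCoprod.summand F G (Quotient.mk'' τ) (v ∘ c)) =
      Equiv.Perm.sign τ • (f (v ∘ replaceOn A p fun i => c (τ (Sum.inl i))) *
        g (v ∘ replaceOn B q fun i => c (τ (Sum.inr i)))) := by
    intro τ
    have h : AlternatingMap.domCoprod.summand F G (Quotient.mk'' τ) (v ∘ c) =
        Equiv.Perm.sign τ • (F (fun i => v (c (τ (Sum.inl i)))) ⊗ₜ[R]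
          G (fun i => v (c (τ (Sum.inr i))))) := rfl
    rw [h, Units.smul_def, map_zsmul, LinearMap.mul'_apply, AlternatingMap.restrictDom_apply,
      AlternatingMap.restrictDom_apply, Units.smul_def]
    congr 3 <;> · ext1 j; simp only [replaceOn, Function.comp]; split_ifs <;> rfl
  have hzero : LinearMap.mul' R R (F.domCoprod G (v ∘ c)) = 0 := by
    rw [← LinearMap.compAlternatingMap_apply]
    refine AlternatingMap.map_linearDependent _ _ fun h => ?_
    have := h.fintype_card_le_finrank
    rw [Fintype.card_sum] at this
    omega
  rw [AlternatingMap.domCoprod_apply, sum_apply, map_sum] at hzero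
  replace hzero := (Finset.add_sum_erase _ _
    (Finset.mem_univ (Quotient.mk'' 1 : Equiv.Perm.ModSumCongr {i // p i} {i // q i}))).trans hzero
  have h1 : (f (v ∘ A) * g (v ∘ B)) =
      LinearMap.mul' R R (AlternatingMap.domCoprod.summand F G (Quotient.mk'' 1) (v ∘ c)) := by
    rw [key]
    simp only [Equiv.Perm.sign_one, one_smul, Equiv.Perm.coe_one, id, hc, Sum.elim_inl,
      Sum.elim_inr]
    congr 2 <;> · congr 1; ext1 j; simp [replaceOn]
  rw [h1, eq_neg_of_add_eq_zero_left hzero]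
  refine W.neg_mem (W.sum_mem fun σ hσ => ?_)
  induction σ using Quotient.inductionOn' with
  | h τ =>
    rw [key, Units.smul_def]
    refine W.zsmul_mem (hW τ fun hτ => ?_) _
    refine (Finset.mem_erase.1 hσ).1 (QuotientGroup.eq.2 ?_)
    simpa using hτ

/-- Exchanging entries between a family of large and a family of small numbers decreases the
sum over the first family. -/
theorem sum_inl_perm_lt {β γ : Type*} [Fintype β] [Fintype γ] (c : β ⊕ γ → ℤ) (m : ℤ)
    (hl : ∀ x, m ≤ c (Sum.inl x)) (hr : ∀ y, c (Sum.inr y) < m) (τ : Equiv.Perm (β ⊕ γ))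
    (hτ : τ ∉ (Equiv.Perm.sumCongrHom β γ).range) :
    ∑ x, c (τ (Sum.inl x)) < ∑ x, c (Sum.inl x) := by
  have hex : ∃ x y, τ (Sum.inl x) = Sum.inr y := by
    by_contra! h
    refine hτ (Equiv.Perm.mem_sumCongrHom_range_of_perm_mapsTo_inl ?_)
    rintro _ ⟨x, rfl⟩
    rcases hx : τ (Sum.inl x) with z | y
    · exact ⟨z, rfl⟩
    · exact absurd hx (h x y)
  obtain ⟨x₀, y₀, h₀⟩ := hex
  have h1 : ∑ x, (c (τ (Sum.inl x)) - m) < ∑ x, max (c (τ (Sum.inl x)) - m) 0 :=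
    Finset.sum_lt_sum (fun _ _ => le_max_left _ _) ⟨x₀, Finset.mem_univ _, by
      rw [h₀]; exact lt_max_of_lt_right (by linarith [hr y₀])⟩
  have h2 : ∑ x, max (c (τ (Sum.inl x)) - m) 0 ≤ ∑ z, max (c (τ z) - m) 0 := by
    rw [Fintype.sum_sum_type]
    exact le_add_of_nonneg_right (Finset.sum_nonneg fun _ _ => le_max_right _ _)
  have h3 : ∑ z, max (c (τ z) - m) 0 = ∑ x, (c (Sum.inl x) - m) := by
    rw [Equiv.sum_comp τ fun z => max (c z - m) 0, Fintype.sum_sum_type]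
    simp only [max_eq_left (sub_nonneg.2 (hl _)), max_eq_right (sub_nonpos.2 (hr _).le),
      Finset.sum_const_zero, add_zero]
  have h4 := h1.trans_le (h2.trans_eq h3)
  simp only [Finset.sum_sub_distrib] at h4
  linarith

section Straightening

variable {k n : ℕ}

instance : Finite (AIdx k n) := inferInstanceAs (Finite {a : Fin k → Fin n // StrictMono a})

/-- The sum of the entries of `a`. -/
def AIdx.total (a : AIdx k n) : ℕ := ∑ i, (a.1 i : ℕ)

theorem AIdx.total_le (a : AIdx k n) : a.total ≤ k * n := by
  simpa [AIdx.total] using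
    Finset.sum_le_card_nsmul Finset.univ (fun i => (a.1 i : ℕ)) n fun i _ => (a.1 i).2.le

/-- A weight which decreases when the totals of two indices are moved apart. -/
def AIdx.defect (a : AIdx k n) : ℕ := (k * n) ^ 2 - a.total ^ 2

theorem AIdx.defect_lt {a b a' b' : AIdx k n} (hab : a.total ≤ b.total)
    (h : a'.total < a.total) (hsum : a'.total + b'.total = a.total + b.total) :
    a'.defect + b'.defect < a.defect + b.defect := by
  have key : a.total ^ 2 + b.total ^ 2 < a'.total ^ 2 + b'.total ^ 2 := by nlinarith
  have := Nat.pow_le_pow_left a.total_le 2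
  have := Nat.pow_le_pow_left b.total_le 2
  have := Nat.pow_le_pow_left a'.total_le 2
  have := Nat.pow_le_pow_left b'.total_le 2
  unfold AIdx.defect
  omega

/-- An exponent is standard if its support is a chain. -/
def IsStandard (s : AIdx k n →₀ ℕ) : Prop :=
  ∀ a ∈ s.support, ∀ b ∈ s.support, a.1 ≤ b.1 ∨ b.1 ≤ a.1

/-- The products `p_a · p_b` with `total a < d` and `total a + total b = e`. -/
def exchangeProducts {B : Type*} [Mul B] (p : AIdx k n → B) (d e : ℕ) : Set B :=
  {x | ∃ a b, a.total < d ∧ a.total + b.total = e ∧ x = p a * p b}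

/-- The monomial in the `p a` with exponent `s`. -/
def mon {B : Type*} [CommMonoid B] (p : AIdx k n → B) (s : AIdx k n →₀ ℕ) : B :=
  s.prod fun a e => p a ^ e

theorem mon_add {B : Type*} [CommMonoid B] (p : AIdx k n → B) (s t : AIdx k n →₀ ℕ) :
    mon p (s + t) = mon p s * mon p t :=
  Finsupp.prod_add_index' (fun _ => pow_zero _) fun _ _ _ => pow_add _ _ _

theorem mon_single {B : Type*} [CommMonoid B] (p : AIdx k n → B) (a : AIdx k n) :
    mon p (Finsupp.single a 1) = p a := by
  simp [mon, Finsupp.prod_single_index]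

theorem map_mon {B B' F : Type*} [CommMonoid B] [CommMonoid B'] [FunLike F B B']
    [MonoidHomClass F B B'] (f : F) (p : AIdx k n → B) (s : AIdx k n →₀ ℕ) :
    f (mon p s) = mon (fun a => f (p a)) s := by
  simp [mon, map_finsuppProd]

theorem aeval_eq_sum_mon {K B : Type*} [CommRing K] [CommRing B] [Algebra K B]
    (p : AIdx k n → B) (f : MvPolynomial (AIdx k n) K) :
    aeval p f = ∑ s ∈ f.support, coeff s f • mon p s := by
  simp [aeval_def, eval₂_eq, mon, Algebra.smul_def, Finsupp.prod]

/-- Straightening: if products of incomparable generators can be rewritten, then the standard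
monomials span. -/
theorem mon_mem_span_standard {K B : Type*} [CommRing K] [CommRing B] [Algebra K B]
    (p : AIdx k n → B)
    (hp : ∀ a b : AIdx k n, ¬ a.1 ≤ b.1 → ¬ b.1 ≤ a.1 → a.total ≤ b.total →
      p a * p b ∈ Submodule.span K (exchangeProducts p a.total (a.total + b.total)))
    (s : AIdx k n →₀ ℕ) :
    mon p s ∈ Submodule.span K (Set.range fun s : {s : AIdx k n →₀ ℕ // IsStandard s} =>
      mon p s.1) := by
  set T := Submodule.span K (Set.range fun s : {s : AIdx k n →₀ ℕ // IsStandard s} => mon p s.1)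
  induction hN : Finsupp.weight AIdx.defect s using Nat.strong_induction_on generalizing s with
  | _ N ih =>
  by_cases hs : IsStandard s
  · exact Submodule.subset_span ⟨⟨s, hs⟩, rfl⟩
  obtain ⟨a, ha, b, hb, hab, hba, htot⟩ : ∃ a ∈ s.support, ∃ b ∈ s.support,
      ¬ a.1 ≤ b.1 ∧ ¬ b.1 ≤ a.1 ∧ a.total ≤ b.total := by
    simp only [IsStandard, not_forall, not_or] at hs
    obtain ⟨a, ha, b, hb, h1, h2⟩ := hs
    rcases le_total a.total b.total with h | h
    · exact ⟨a, ha, b, hb, h1, h2, h⟩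
    · exact ⟨b, hb, a, ha, h2, h1, h⟩
  have hne : a ≠ b := fun h => hab (h ▸ le_rfl)
  obtain ⟨r, rfl⟩ : ∃ r, s = r + (Finsupp.single a 1 + Finsupp.single b 1) := by
    refine ⟨s - (Finsupp.single a 1 + Finsupp.single b 1), (tsub_add_cancel_of_le ?_).symm⟩
    intro c
    rw [Finsupp.mem_support_iff] at ha hb
    rcases eq_or_ne a c with rfl | hac
    · simpa [hne.symm, Nat.one_le_iff_ne_zero] using ha
    · rcases eq_or_ne b c with rfl | hbc
      · simpa [hne, Nat.one_le_iff_ne_zero] using hb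
      · simp [hac, hbc]
  have hmul := Submodule.mem_map_of_mem (f := LinearMap.mulLeft K (mon p r)) (hp a b hab hba htot)
  rw [Submodule.map_span, LinearMap.mulLeft_apply] at hmul
  rw [mon_add, mon_add, mon_single, mon_single]
  refine Submodule.span_le.2 ?_ hmul
  rintro _ ⟨_, ⟨a', b', hlt, hsum, rfl⟩, rfl⟩
  have hd := AIdx.defect_lt htot hlt hsum
  have := ih (Finsupp.weight AIdx.defect (r + (Finsupp.single a' 1 + Finsupp.single b' 1)))
    (by subst hN; simpa [Finsupp.weight_single] using hd) _ rfl
  rwa [mon_add, mon_add, mon_single, mon_single] at this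

end Straightening

section Minors

variable {k n : ℕ}

/-- The columns of the generic matrix. -/
noncomputable def colVec (k n : ℕ) (j : Fin n) : Fin k → MvPolynomial (Fin k × Fin n) ℂ :=
  fun i => X (i, j)

theorem plueckerMinor_eq (a : AIdx k n) :
    plueckerMinor k n a = Matrix.detRowAlternating (colVec k n ∘ a.1) := by
  rw [plueckerMinor, ← Matrix.det_transpose]
  rfl

/-- The minor with arbitrary columns `A` is zero or, up to sign, some `p_a`. -/
theorem det_colVec (A : Fin k → Fin n) :
    Matrix.detRowAlternating (colVec k n ∘ A) = 0 ∨
      ∃ a : AIdx k n, a.total = ∑ i, (A i : ℕ) ∧ ∃ u : ℤˣ,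
        Matrix.detRowAlternating (colVec k n ∘ A) = u • plueckerMinor k n a := by
  by_cases hA : Function.Injective A
  · let a : AIdx k n := ⟨A ∘ Tuple.sort A, (Tuple.monotone_sort A).strictMono_of_injective
      (hA.comp (Equiv.injective _))⟩
    refine Or.inr ⟨a, Equiv.sum_comp (Tuple.sort A) fun i => (A i : ℕ),
      Equiv.Perm.sign (Tuple.sort A), ?_⟩
    rw [plueckerMinor_eq]
    change _ = _ • Matrix.detRowAlternating ((colVec k n ∘ A) ∘ Tuple.sort A)
    rw [AlternatingMap.map_perm, smul_smul, Int.units_mul_self, one_smul]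
  · exact Or.inl (AlternatingMap.map_eq_zero_of_not_injective _ _ fun h => hA h.of_comp)

theorem sum_replaceOn {ι : Type*} [Fintype ι] (A : ι → Fin n) (p : ι → Prop) [DecidablePred p]
    (c : {i // p i} → Fin n) :
    ∑ i, ((replaceOn A p c i : Fin n) : ℤ) = ∑ i, (c i : ℤ) + ∑ i : {i // ¬ p i}, (A i.1 : ℤ) := by
  rw [← Fintype.sum_subtype_add_sum_subtype p]
  congr 1 <;> refine Finset.sum_congr rfl fun i _ => ?_ <;> simp [replaceOn, i.2]

theorem plueckerMinor_mul_mem (a b : AIdx k n) (h : ¬ a.1 ≤ b.1) :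
    plueckerMinor k n a * plueckerMinor k n b ∈
      Submodule.span ℂ (exchangeProducts (plueckerMinor k n) a.total (a.total + b.total)) := by
  set W := Submodule.span ℂ (exchangeProducts (plueckerMinor k n) a.total (a.total + b.total))
  obtain ⟨s, hs⟩ : ∃ s, b.1 s < a.1 s := by simpa [Pi.le_def] using h
  rw [plueckerMinor_eq a, plueckerMinor_eq b]
  refine AlternatingMap.exchange_mem _ _ (s ≤ ·) (· ≤ s) ?_ _ _ _ W.toAddSubgroup fun τ hτ => ?_
  · have h1 : Fintype.card {i : Fin k // s ≤ i} = k - s := by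
      rw [Fintype.card_of_subtype (Finset.Ici s) (by simp), Fin.card_Ici]
    have h2 : Fintype.card {i : Fin k // i ≤ s} = s + 1 := by
      rw [Fintype.card_of_subtype (Finset.Iic s) (by simp), Fin.card_Iic]
    rw [h1, h2, Module.finrank_fin_fun]
    omega
  rw [Submodule.mem_toAddSubgroup]
  set c : {i // s ≤ i} ⊕ {i // i ≤ s} → Fin n :=
    Sum.elim (fun i => a.1 i.1) (fun i => b.1 i.1) with hc
  have hlt := sum_inl_perm_lt (fun x => (c x : ℤ)) (a.1 s)
    (fun x => by simpa [hc] using a.2.monotone x.2)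
    (fun y => by simpa [hc] using (b.2.monotone y.2).trans_lt hs) τ hτ
  have hall := Equiv.sum_comp τ fun x => (c x : ℤ)
  rw [Fintype.sum_sum_type, Fintype.sum_sum_type] at hall
  have hA := sum_replaceOn a.1 (s ≤ ·) fun i => c (τ (Sum.inl i))
  have hB := sum_replaceOn b.1 (· ≤ s) fun i => c (τ (Sum.inr i))
  have hA₀ := Fintype.sum_subtype_add_sum_subtype (s ≤ ·) fun i => (a.1 i : ℤ)
  have hB₀ := Fintype.sum_subtype_add_sum_subtype (· ≤ s) fun i => (b.1 i : ℤ)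
  have hcl : ∀ x, c (Sum.inl x) = a.1 x.1 := fun _ => rfl
  have hcr : ∀ x, c (Sum.inr x) = b.1 x.1 := fun _ => rfl
  simp only [hcl, hcr] at hlt hall
  have hta : (a.total : ℤ) = ∑ i, (a.1 i : ℤ) := by simp [AIdx.total]
  have htb : (b.total : ℤ) = ∑ i, (b.1 i : ℤ) := by simp [AIdx.total]
  rcases det_colVec (replaceOn a.1 (s ≤ ·) fun i => c (τ (Sum.inl i))) with h0 | ⟨a', ha', u, hu⟩
  · rw [h0, zero_mul]; exact W.zero_mem
  rcases det_colVec (replaceOn b.1 (· ≤ s) fun i => c (τ (Sum.inr i))) with h0 | ⟨b', hb', v, hv⟩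
  · rw [h0, mul_zero]; exact W.zero_mem
  rw [hu, hv, smul_mul_smul_comm, Units.smul_def]
  replace ha' := congrArg (Nat.cast (R := ℤ)) ha'
  replace hb' := congrArg (Nat.cast (R := ℤ)) hb'
  push_cast at ha' hb'
  have hmem : plueckerMinor k n a' * plueckerMinor k n b' ∈ W := by
    refine Submodule.subset_span ⟨a', b', ?_, ?_, rfl⟩
    · zify
      linarith
    · zify
      linarith
  exact zsmul_mem hmem _

end Minors

section Hibi

variable {k n : ℕ}

/-- A homomorphism is injective if the standard monomials span and have linearly independent
images. -/
theorem injective_of_standard {K B B' : Type*} [CommRing K] [CommRing B] [CommRing B']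
    [Algebra K B] [Algebra K B'] (f : B →ₐ[K] B') (p : AIdx k n → B)
    (hspan : ∀ b, b ∈ Submodule.span K
      (Set.range fun s : {s : AIdx k n →₀ ℕ // IsStandard s} => mon p s.1))
    (hind : LinearIndependent K
      fun s : {s : AIdx k n →₀ ℕ // IsStandard s} => mon (fun a => f (p a)) s.1) :
    Function.Injective f := by
  rw [injective_iff_map_eq_zero]
  intro b hb
  obtain ⟨c, rfl⟩ := Finsupp.mem_span_range_iff_exists_finsupp.1 (hspan b)
  have : c = 0 := by
    refine (linearIndependent_iff.1 hind) c ?_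
    rw [← hb, Finsupp.linearCombination_apply, map_finsuppSum]
    simp [map_mon]
  simp [this]

/-- The exponent of the diagonal term of `p_a`. -/
noncomputable def diagExp (a : AIdx k n) : Fin k × Fin n →₀ ℕ :=
  ∑ i, Finsupp.single (i, a.1 i) 1

/-- The diagonal term of `p_a`. -/
noncomputable def diagMon (a : AIdx k n) : MvPolynomial (Fin k × Fin n) ℂ :=
  ∏ i, X (i, a.1 i)

theorem diagMon_eq (a : AIdx k n) : diagMon a = monomial (diagExp a) 1 := by
  rw [diagMon, diagExp, monomial_sum_one]
  rfl

theorem diagExp_apply (a : AIdx k n) (i : Fin k) (j : Fin n) :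
    diagExp a (i, j) = if a.1 i = j then 1 else 0 := by
  classical
  simp [diagExp, Finsupp.finsetSum_apply, Finsupp.single_apply, Prod.ext_iff, ite_and,
    Finset.sum_ite_eq']

theorem mon_diagMon (s : AIdx k n →₀ ℕ) :
    mon diagMon s = monomial (Finsupp.weight diagExp s) 1 := by
  simp only [mon, diagMon_eq, monomial_pow, one_pow, Finsupp.weight_apply, Finsupp.prod,
    Finsupp.sum, monomial_sum_one]

theorem weight_diagExp_ne_zero (s : AIdx k n →₀ ℕ) (i : Fin k) (j : Fin n) :
    Finsupp.weight diagExp s (i, j) ≠ 0 ↔ ∃ a ∈ s.support, a.1 i = j := by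
  simp only [Finsupp.weight_apply, Finsupp.sum, Finsupp.finsetSum_apply, Finsupp.smul_apply,
    diagExp_apply, smul_eq_mul, ne_eq, Finset.sum_eq_zero_iff, not_forall]
  refine exists_congr fun a => ?_
  simp +contextual [and_comm]

theorem IsStandard.exists_top {s : AIdx k n →₀ ℕ} (hs : IsStandard s) (h0 : s ≠ 0) :
    ∃ m ∈ s.support, ∀ b ∈ s.support, b.1 ≤ m.1 := by
  obtain ⟨m, hm, hmax⟩ := Finset.exists_maximalFor (fun a : AIdx k n => a.1) s.support
    (Finsupp.support_nonempty_iff.2 h0)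
  exact ⟨m, hm, fun b hb => (hs b hb m hm).elim id fun h => hmax hb h⟩

theorem top_le_top {s t : AIdx k n →₀ ℕ}
    (h : Finsupp.weight diagExp s = Finsupp.weight diagExp t) {m m' : AIdx k n}
    (hm : m ∈ s.support) (hm' : ∀ b ∈ t.support, b.1 ≤ m'.1) : m.1 ≤ m'.1 := by
  intro i
  have h1 := (weight_diagExp_ne_zero s i (m.1 i)).2 ⟨m, hm, rfl⟩
  rw [h] at h1
  obtain ⟨b, hb, hbi⟩ := (weight_diagExp_ne_zero t i (m.1 i)).1 h1
  exact hbi ▸ hm' b hb i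

theorem weight_diagExp_eq_zero (hk : 1 ≤ k) {s : AIdx k n →₀ ℕ}
    (h : Finsupp.weight diagExp s = 0) : s = 0 := by
  by_contra h0
  obtain ⟨a, ha⟩ := Finsupp.support_nonempty_iff.2 h0
  exact (weight_diagExp_ne_zero s ⟨0, hk⟩ _).2 ⟨a, ha, rfl⟩ (by rw [h]; rfl)

theorem IsStandard.of_add {s t : AIdx k n →₀ ℕ} (h : IsStandard (s + t)) : IsStandard s :=
  fun a ha b hb => h a (Finsupp.support_mono le_self_add ha) b
    (Finsupp.support_mono le_self_add hb)

/-- A standard exponent is determined by the product of the diagonal terms. -/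
theorem weight_diagExp_injOn (hk : 1 ≤ k) {s t : AIdx k n →₀ ℕ} (hs : IsStandard s)
    (ht : IsStandard t) (h : Finsupp.weight diagExp s = Finsupp.weight diagExp t) : s = t := by
  induction hN : s.degree generalizing s t with
  | zero =>
    rw [Finsupp.degree_eq_zero_iff] at hN
    subst hN
    exact (weight_diagExp_eq_zero hk (h.symm.trans (map_zero _))).symm
  | succ N ih =>
    have hs0 : s ≠ 0 := by rintro rfl; simp at hN
    have ht0 : t ≠ 0 := by
      rintro rfl
      exact hs0 (weight_diagExp_eq_zero hk (h.trans (map_zero _)))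
    obtain ⟨m, hm, hmax⟩ := hs.exists_top hs0
    obtain ⟨m', hm', hmax'⟩ := ht.exists_top ht0
    obtain rfl : m = m' :=
      Subtype.ext (le_antisymm (top_le_top h hm hmax') (top_le_top h.symm hm' hmax))
    have split : ∀ u : AIdx k n →₀ ℕ, m ∈ u.support → ∃ r, u = r + Finsupp.single m 1 :=
      fun u hu => ⟨u - Finsupp.single m 1, (tsub_add_cancel_of_le (by
        rw [Finsupp.single_le_iff]
        exact Nat.one_le_iff_ne_zero.2 (Finsupp.mem_support_iff.1 hu))).symm⟩
    obtain ⟨r, rfl⟩ := split s hm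
    obtain ⟨r', rfl⟩ := split t hm'
    rw [map_add, map_add, add_left_inj] at h
    rw [ih hs.of_add ht.of_add h (by simpa using hN)]

theorem linearIndependent_mon_diagMon (hk : 1 ≤ k) :
    LinearIndependent ℂ fun s : {s : AIdx k n →₀ ℕ // IsStandard s} => mon diagMon s.1 := by
  have := (basisMonomials (Fin k × Fin n) ℂ).linearIndependent.comp
    (fun s : {s : AIdx k n →₀ ℕ // IsStandard s} => Finsupp.weight diagExp s.1)
    fun s t h => Subtype.ext (weight_diagExp_injOn hk s.2 t.2 h)
  simpa only [Function.comp_def, coe_basisMonomials, ← mon_diagMon] using this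

/-- Componentwise minimum. -/
def AIdx.inf_s4 (a b : AIdx k n) : AIdx k n :=
  ⟨fun i => min (a.1 i) (b.1 i), fun _ _ h => min_lt_min (a.2 h) (b.2 h)⟩

/-- Componentwise maximum. -/
def AIdx.sup_s4 (a b : AIdx k n) : AIdx k n :=
  ⟨fun i => max (a.1 i) (b.1 i), fun _ _ h => max_lt_max (a.2 h) (b.2 h)⟩

theorem AIdx.total_inf_lt {a b : AIdx k n} (h : ¬ a.1 ≤ b.1) : (a.inf_s4 b).total < a.total := by
  obtain ⟨s, hs⟩ : ∃ s, b.1 s < a.1 s := by simpa [Pi.le_def] using h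
  exact Finset.sum_lt_sum (fun i _ => Fin.le_def.1 (min_le_left _ _))
    ⟨s, Finset.mem_univ _, Fin.lt_def.1 (min_lt_of_right_lt hs)⟩

theorem AIdx.total_inf_add_total_sup (a b : AIdx k n) :
    (a.inf_s4 b).total + (a.sup_s4 b).total = a.total + b.total := by
  simp only [AIdx.total, ← Finset.sum_add_distrib]
  refine Finset.sum_congr rfl fun i _ => ?_
  change ((min (a.1 i) (b.1 i) : Fin n) : ℕ) + ((max (a.1 i) (b.1 i) : Fin n) : ℕ) = _
  rcases le_total (a.1 i) (b.1 i) with h | h <;> simp [h, add_comm]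

theorem diagMon_mul_of_min_max {a b m M : AIdx k n} (hm : ∀ i, m.1 i = min (a.1 i) (b.1 i))
    (hM : ∀ i, M.1 i = max (a.1 i) (b.1 i)) :
    diagMon a * diagMon b = diagMon m * diagMon M := by
  simp only [diagMon, ← Finset.prod_mul_distrib]
  refine Finset.prod_congr rfl fun i _ => ?_
  rw [hm, hM]
  rcases le_total (a.1 i) (b.1 i) with h | h <;> simp [h, mul_comm]

theorem hibiIdeal_le_ker (f : MvPolynomial (AIdx k n) ℂ) (hf : f ∈ hibiIdeal k n) :
    aeval (R := ℂ) diagMon f = 0 := by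
  suffices h : hibiIdeal k n ≤ RingHom.ker (aeval (R := ℂ) (diagMon (k := k) (n := n))) from
    h hf
  refine Ideal.span_le.2 ?_
  rintro _ ⟨a, b, m, M, -, -, hm, hM, rfl⟩
  simp [RingHom.mem_ker, diagMon_mul_of_min_max hm hM]

/-- The Hibi ring maps to the polynomial ring by sending `z_a` to the diagonal term of `p_a`. -/
noncomputable def hibiLift (k n : ℕ) :
    (MvPolynomial (AIdx k n) ℂ ⧸ hibiIdeal k n) →ₐ[ℂ] MvPolynomial (Fin k × Fin n) ℂ :=
  Ideal.Quotient.liftₐ (hibiIdeal k n) (aeval diagMon) hibiIdeal_le_ker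

theorem hibi_mem_span (b : MvPolynomial (AIdx k n) ℂ ⧸ hibiIdeal k n) :
    b ∈ Submodule.span ℂ (Set.range fun s : {s : AIdx k n →₀ ℕ // IsStandard s} =>
      mon (fun a => Ideal.Quotient.mkₐ ℂ (hibiIdeal k n) (X a)) s.1) := by
  obtain ⟨f, rfl⟩ := Ideal.Quotient.mkₐ_surjective ℂ _ b
  have hf : Ideal.Quotient.mkₐ ℂ (hibiIdeal k n) f =
      aeval (fun a => Ideal.Quotient.mkₐ ℂ (hibiIdeal k n) (X a)) f :=
    DFunLike.congr_fun (aeval_unique (Ideal.Quotient.mkₐ ℂ (hibiIdeal k n))) f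
  rw [hf, aeval_eq_sum_mon]
  refine Submodule.sum_mem _ fun s _ => Submodule.smul_mem _ _ (mon_mem_span_standard _ ?_ s)
  intro a b hab hba _
  refine Submodule.subset_span ⟨a.inf_s4 b, a.sup_s4 b, AIdx.total_inf_lt hab,
    AIdx.total_inf_add_total_sup a b, ?_⟩
  rw [← map_mul, ← map_mul]
  exact (Ideal.Quotient.mk_eq_mk_iff_sub_mem _ _).2 (Ideal.subset_span
    ⟨a, b, a.inf_s4 b, a.sup_s4 b, hab, hba, fun _ => rfl, fun _ => rfl, rfl⟩)

theorem hibiLift_injective (hk : 1 ≤ k) : Function.Injective (hibiLift k n) := by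
  refine injective_of_standard _ _ hibi_mem_span ?_
  have h : ∀ a : AIdx k n,
      hibiLift k n (Ideal.Quotient.mkₐ ℂ (hibiIdeal k n) (X a)) = diagMon a :=
    fun a => aeval_X diagMon a
  simpa only [h] using linearIndependent_mon_diagMon hk

/-- The Hibi ring is the algebra generated by the diagonal terms. -/
theorem nonempty_hibiEquiv (hk : 1 ≤ k) :
    Nonempty ((aeval (R := ℂ) (diagMon (k := k) (n := n))).range ≃ₐ[ℂ] HibiRing k n) := by
  have h : (aeval (R := ℂ) (diagMon (k := k) (n := n))).range = (hibiLift k n).range := by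
    ext x
    constructor
    · rintro ⟨f, rfl⟩
      exact ⟨Ideal.Quotient.mkₐ ℂ _ f, rfl⟩
    · rintro ⟨f, rfl⟩
      obtain ⟨f, rfl⟩ := Ideal.Quotient.mkₐ_surjective ℂ _ f
      exact ⟨f, rfl⟩
  exact ⟨(Subalgebra.equivOfEq _ _ h).trans
    (AlgEquiv.ofInjective _ (hibiLift_injective hk)).symm⟩

end Hibi

section Deformation

variable {k n : ℕ}

/-- Weights on the variables `x_{i,j}` for which the diagonal term of every minor is the unique
term of minimal weight. -/
def varWeight (i : Fin k) (j : Fin n) : ℕ := (i.rev : ℕ) * j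

/-- The weight of the diagonal term of `p_a`. -/
def AIdx.diagWeight (a : AIdx k n) : ℕ := ∑ i, varWeight i (a.1 i)

theorem AIdx.diagWeight_lt (a : AIdx k n) {σ : Equiv.Perm (Fin k)} (hσ : σ ≠ 1) :
    a.diagWeight < ∑ i, varWeight (σ i) (a.1 i) := by
  have hf : StrictAnti fun i : Fin k => ((i.rev : ℕ) : ℤ) := fun i j h => by
    exact Nat.cast_lt.2 (Fin.lt_def.1 (Fin.rev_lt_rev.2 h))
  have hg : StrictMono fun i : Fin k => ((a.1 i : ℕ) : ℤ) := fun i j h => by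
    exact Nat.cast_lt.2 (Fin.lt_def.1 (a.2 h))
  have key := ((hf.antitone.antivary hg.monotone).sum_mul_lt_sum_comp_perm_mul_iff (σ := σ)).2
    fun h => hσ (by
      have hmono : Monotone σ := fun i j hij => by
        rcases hij.eq_or_lt with rfl | hij
        · exact le_rfl
        · exact hf.le_iff_ge.1 (h (hg hij))
      have hstrict := hmono.strictMono_of_injective σ.injective
      ext1 i
      exact DFunLike.congr_fun (Subsingleton.elim
        (hstrict.orderIsoOfSurjective σ σ.surjective) (OrderIso.refl (Fin k))) i)
  unfold AIdx.diagWeight varWeight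
  exact_mod_cast key

/-- The deformed minors, over `ℂ[t]`. -/
noncomputable def deformedMinor (a : AIdx k n) :
    MvPolynomial (Fin k × Fin n) (Polynomial ℂ) :=
  ∑ σ : Equiv.Perm (Fin k), Equiv.Perm.sign σ •
    (C (Polynomial.X ^ (∑ i, varWeight (σ i) (a.1 i) - a.diagWeight)) * ∏ i, X (σ i, a.1 i))

/-- Homogenization with respect to the weights `varWeight`. -/
noncomputable def homogenize (k n : ℕ) :
    MvPolynomial (Fin k × Fin n) ℂ →ₐ[ℂ] MvPolynomial (Fin k × Fin n) (Polynomial ℂ) :=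
  aeval fun ij => C (Polynomial.X ^ varWeight ij.1 ij.2) * X ij

theorem homogenize_plueckerMinor (a : AIdx k n) :
    homogenize k n (plueckerMinor k n a) =
      C (Polynomial.X ^ a.diagWeight) * deformedMinor a := by
  rw [plueckerMinor, Matrix.det_apply, map_sum, deformedMinor, Finset.mul_sum]
  refine Finset.sum_congr rfl fun σ _ => ?_
  have hle : a.diagWeight ≤ ∑ i, varWeight (σ i) (a.1 i) := by
    by_cases h : σ = 1
    · subst h; exact le_rfl
    · exact (a.diagWeight_lt h).le
  rw [Units.smul_def, Units.smul_def, map_zsmul, mul_smul_comm, ← mul_assoc, ← C_mul, ← pow_add,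
    Nat.add_sub_cancel' hle, map_prod]
  simp [homogenize, Finset.prod_mul_distrib, ← Finset.prod_pow_eq_pow_sum]

theorem homogenize_mon (s : AIdx k n →₀ ℕ) :
    homogenize k n (mon (plueckerMinor k n) s) =
      C (Polynomial.X ^ Finsupp.weight AIdx.diagWeight s) * mon deformedMinor s := by
  rw [map_mon]
  simp only [homogenize_plueckerMinor, mon, mul_pow, Finsupp.prod, Finset.prod_mul_distrib,
    Finsupp.weight_apply, Finsupp.sum, ← Finset.prod_pow_eq_pow_sum, map_prod, smul_eq_mul]
  congr 1
  refine Finset.prod_congr rfl fun a _ => ?_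
  rw [← C_pow, ← pow_mul, mul_comm]

/-- Specialization at `t = c`. -/
noncomputable def specialize (k n : ℕ) (c : ℂ) :
    MvPolynomial (Fin k × Fin n) (Polynomial ℂ) →ₐ[ℂ] MvPolynomial (Fin k × Fin n) ℂ :=
  mapAlgHom (Polynomial.aeval c)

@[simp] theorem specialize_C (c : ℂ) (g : Polynomial ℂ) :
    specialize k n c (C g) = C (g.eval c) := by
  simp [specialize]

@[simp] theorem specialize_X (c : ℂ) (ij : Fin k × Fin n) :
    specialize k n c (X ij) = X ij := by
  simp [specialize]

theorem specialize_smul (c : ℂ) (g : Polynomial ℂ)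
    (q : MvPolynomial (Fin k × Fin n) (Polynomial ℂ)) :
    specialize k n c (g • q) = g.eval c • specialize k n c q := by
  rw [smul_eq_C_mul, smul_eq_C_mul, map_mul, specialize_C]

theorem specialize_zero_deformedMinor (a : AIdx k n) :
    specialize k n 0 (deformedMinor a) = diagMon a := by
  rw [deformedMinor, map_sum, Finset.sum_eq_single 1]
  · simp [AIdx.diagWeight, diagMon]
  · intro σ _ hσ
    have := Nat.sub_ne_zero_of_lt (a.diagWeight_lt hσ)
    rw [Units.smul_def, map_zsmul, map_mul, specialize_C]
    simp [this]
  · simp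

theorem C_X_pow_ne_zero (d : ℕ) :
    (C (Polynomial.X ^ d) : MvPolynomial (Fin k × Fin n) (Polynomial ℂ)) ≠ 0 := by
  simp

/-- A combination of homogenized standard monomials divisible by `t ^ d` only involves monomials
of weight at least `d`. -/
theorem le_weight_of_dvd (hk : 1 ≤ k) (l : {s : AIdx k n →₀ ℕ // IsStandard s} →₀ ℂ) (d : ℕ)
    (h : C (Polynomial.X ^ d) ∣
      homogenize k n (l.sum fun s c => c • mon (plueckerMinor k n) s.1)) :
    ∀ s ∈ l.support, d ≤ Finsupp.weight AIdx.diagWeight s.1 := by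
  by_contra! hcon
  obtain ⟨s₁, hs₁, hlt₁⟩ := hcon
  obtain ⟨s₀, hs₀, hmin⟩ := Finset.exists_min_image l.support
    (fun s => Finsupp.weight AIdx.diagWeight s.1) ⟨s₁, hs₁⟩
  set w := Finsupp.weight AIdx.diagWeight s₀.1 with hw
  have hwd : w < d := (hmin s₁ hs₁).trans_lt hlt₁
  obtain ⟨q, hq⟩ := h
  have hfac : C (Polynomial.X ^ w) * (∑ s ∈ l.support, l s •
      (C (Polynomial.X ^ (Finsupp.weight AIdx.diagWeight s.1 - w)) * mon deformedMinor s.1)) =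
      C (Polynomial.X ^ w) * (C (Polynomial.X ^ (d - w)) * q) := by
    rw [← mul_assoc, ← C_mul, ← pow_add, Nat.add_sub_cancel' hwd.le, ← hq, Finsupp.sum, map_sum,
      Finset.mul_sum]
    refine Finset.sum_congr rfl fun s hs => ?_
    rw [map_smul, homogenize_mon, mul_smul_comm, ← mul_assoc, ← C_mul, ← pow_add,
      Nat.add_sub_cancel' (hmin s hs)]
  have h0 := congrArg (specialize k n 0) (mul_left_cancel₀ (C_X_pow_ne_zero w) hfac)
  have hterm : ∀ s : {s : AIdx k n →₀ ℕ // IsStandard s}, specialize k n 0 (l s •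
      (C (Polynomial.X ^ (Finsupp.weight AIdx.diagWeight s.1 - w)) * mon deformedMinor s.1)) =
      (l s * 0 ^ (Finsupp.weight AIdx.diagWeight s.1 - w)) • mon diagMon s.1 := fun s => by
    rw [map_smul, map_mul, specialize_C, map_mon, Polynomial.eval_pow, Polynomial.eval_X,
      ← smul_eq_C_mul, smul_smul]
    simp only [specialize_zero_deformedMinor]
  rw [map_sum, map_mul, specialize_C, Polynomial.eval_pow, Polynomial.eval_X,
    zero_pow (Nat.sub_ne_zero_of_lt hwd), C_0, zero_mul,
    Finset.sum_congr rfl fun s _ => hterm s] at h0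
  have := linearIndependent_iff'.1 (linearIndependent_mon_diagMon hk) l.support _ h0 s₀ hs₀
  simp [← hw] at this
  exact Finsupp.mem_support_iff.1 hs₀ this

theorem linearIndependent_mon_plueckerMinor (hk : 1 ≤ k) :
    LinearIndependent ℂ
      fun s : {s : AIdx k n →₀ ℕ // IsStandard s} => mon (plueckerMinor k n) s.1 := by
  refine linearIndependent_iff.2 fun l hl => Finsupp.support_eq_empty.1 ?_
  rw [Finsupp.linearCombination_apply] at hl
  refine Finset.eq_empty_of_forall_notMem fun s hs => ?_
  exact absurd (le_weight_of_dvd hk l (Finsupp.weight AIdx.diagWeight s.1 + 1)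
    (by rw [hl, map_zero]; exact dvd_zero _) s hs) (by simp)

theorem mon_plueckerMinor_mem_span (s : AIdx k n →₀ ℕ) :
    mon (plueckerMinor k n) s ∈ Submodule.span ℂ
      (Set.range fun s : {s : AIdx k n →₀ ℕ // IsStandard s} => mon (plueckerMinor k n) s.1) :=
  mon_mem_span_standard _ (fun a b hab _ _ => plueckerMinor_mul_mem a b hab) s

/-- The standard monomials in the deformed minors span all monomials over `ℂ[t]`. -/
theorem mon_deformedMinor_mem_span (hk : 1 ≤ k) (s : AIdx k n →₀ ℕ) :
    mon deformedMinor s ∈ Submodule.span (Polynomial ℂ)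
      (Set.range fun s : {s : AIdx k n →₀ ℕ // IsStandard s} => mon deformedMinor s.1) := by
  obtain ⟨l, hl⟩ := Finsupp.mem_span_range_iff_exists_finsupp.1 (mon_plueckerMinor_mem_span s)
  set w := Finsupp.weight AIdx.diagWeight s with hw
  have hle := le_weight_of_dvd hk l w (by rw [hl, homogenize_mon]; exact dvd_mul_right _ _)
  have hfac : C (Polynomial.X ^ w) * mon deformedMinor s = C (Polynomial.X ^ w) *
      ∑ t ∈ l.support, (Polynomial.C (l t) *
        Polynomial.X ^ (Finsupp.weight AIdx.diagWeight t.1 - w)) • mon deformedMinor t.1 := by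
    rw [hw, ← homogenize_mon, ← hl, Finsupp.sum, map_sum, Finset.mul_sum, ← hw]
    refine Finset.sum_congr rfl fun t ht => ?_
    rw [map_smul, homogenize_mon, smul_eq_C_mul, ← mul_assoc, ← C_mul, mul_left_comm, ← pow_add,
      Nat.add_sub_cancel' (hle t ht), C_mul, mul_assoc, ← smul_eq_C_mul (C _ * _),
      ← Polynomial.algebraMap_eq, algebraMap_smul]
  rw [mul_left_cancel₀ (C_X_pow_ne_zero w) hfac]
  exact Submodule.sum_mem _ fun t _ => Submodule.smul_mem _ _ (Submodule.subset_span ⟨t, rfl⟩)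

/-- The action of `c` on the variables through the weights `varWeight`. -/
noncomputable def rescale (k n : ℕ) (c : ℂ) :
    MvPolynomial (Fin k × Fin n) ℂ →ₐ[ℂ] MvPolynomial (Fin k × Fin n) ℂ :=
  (specialize k n c).comp (homogenize k n)

theorem rescale_X (c : ℂ) (ij : Fin k × Fin n) :
    rescale k n c (X ij) = C (c ^ varWeight ij.1 ij.2) * X ij := by
  simp [rescale, homogenize]

theorem rescale_injective {c : ℂ} (hc : c ≠ 0) : Function.Injective (rescale k n c) := by
  have h : (rescale k n c⁻¹).comp (rescale k n c) = AlgHom.id ℂ _ := by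
    refine algHom_ext fun ij => ?_
    rw [AlgHom.comp_apply, rescale_X, map_mul, rescale_X, ← algebraMap_eq, AlgHom.commutes,
      ← mul_assoc, ← map_mul, ← mul_pow, mul_inv_cancel₀ hc]
    simp
  exact Function.LeftInverse.injective (g := rescale k n c⁻¹) fun x => DFunLike.congr_fun h x

theorem rescale_mon (c : ℂ) (s : AIdx k n →₀ ℕ) :
    rescale k n c (mon (plueckerMinor k n) s) = c ^ Finsupp.weight AIdx.diagWeight s •
      mon (fun a => specialize k n c (deformedMinor a)) s := by
  rw [rescale, AlgHom.comp_apply, homogenize_mon, map_mul, specialize_C, map_mon, smul_eq_C_mul]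
  simp

theorem linearIndependent_mon_specialize (hk : 1 ≤ k) (c : ℂ) :
    LinearIndependent ℂ fun s : {s : AIdx k n →₀ ℕ // IsStandard s} =>
      mon (fun a => specialize k n c (deformedMinor a)) s.1 := by
  rcases eq_or_ne c 0 with rfl | hc
  · simpa only [specialize_zero_deformedMinor] using linearIndependent_mon_diagMon hk
  · have h := ((linearIndependent_mon_plueckerMinor (n := n) hk).map_injOn
      (rescale k n c).toLinearMap (rescale_injective hc).injOn).units_smul
      fun s => (Units.mk0 c hc)⁻¹ ^ Finsupp.weight AIdx.diagWeight s.1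
    have hfun : (fun s : {s : AIdx k n →₀ ℕ // IsStandard s} =>
        mon (fun a => specialize k n c (deformedMinor a)) s.1) =
        (fun s : {s : AIdx k n →₀ ℕ // IsStandard s} =>
          (Units.mk0 c hc)⁻¹ ^ Finsupp.weight AIdx.diagWeight s.1) •
          (⇑(rescale k n c).toLinearMap ∘ fun s : {s : AIdx k n →₀ ℕ // IsStandard s} =>
            mon (plueckerMinor k n) s.1) := by
      ext1 s
      simp only [Pi.smul_apply', Function.comp_apply, AlgHom.toLinearMap_apply, rescale_mon,
        Units.smul_def, smul_smul]
      simp [hc]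
    rw [hfun]
    exact h

set_option maxSynthPendingDepth 3

/-- The total space of the degeneration. -/
noncomputable def deformedAlg (k n : ℕ) :
    Subalgebra (Polynomial ℂ) (MvPolynomial (Fin k × Fin n) (Polynomial ℂ)) :=
  (aeval (R := Polynomial ℂ) (deformedMinor (k := k) (n := n))).range

/-- The restriction of `specialize` to the total space. -/
noncomputable def fiberMap (k n : ℕ) (c : ℂ) :
    deformedAlg k n →ₐ[ℂ] MvPolynomial (Fin k × Fin n) ℂ :=
  (specialize k n c).comp ((deformedAlg k n).val.restrictScalars ℂ)

theorem mon_mem_deformedAlg (s : AIdx k n →₀ ℕ) : mon deformedMinor s ∈ deformedAlg k n :=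
  ⟨mon X s, by simp only [AlgHom.toRingHom_eq_coe, RingHom.coe_coe, map_mon, aeval_X]⟩

theorem ker_fiberMap (hk : 1 ≤ k) (c : ℂ) :
    RingHom.ker (fiberMap k n c) = Ideal.span
      {algebraMap (Polynomial ℂ) (deformedAlg k n) (Polynomial.X - Polynomial.C c)} := by
  apply le_antisymm
  · rintro ⟨x, f, hf⟩ hx
    have hx' : specialize k n c x = 0 := hx
    have hspan : x ∈ Submodule.span (Polynomial ℂ)
        (Set.range fun s : {s : AIdx k n →₀ ℕ // IsStandard s} => mon deformedMinor s.1) := by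
      rw [← hf]
      change aeval deformedMinor f ∈ _
      rw [aeval_eq_sum_mon]
      exact Submodule.sum_mem _ fun s _ =>
        Submodule.smul_mem _ _ (mon_deformedMinor_mem_span hk s)
    obtain ⟨g, hg⟩ := Finsupp.mem_span_range_iff_exists_finsupp.1 hspan
    rw [← hg, Finsupp.sum, map_sum] at hx'
    simp only [specialize_smul, map_mon] at hx'
    have hroot := linearIndependent_iff'.1 (linearIndependent_mon_specialize hk c) g.support _ hx'
    rw [Ideal.mem_span_singleton']
    refine ⟨⟨∑ s ∈ g.support, (g s /ₘ (Polynomial.X - Polynomial.C c)) • mon deformedMinor s.1,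
      Subalgebra.sum_mem _ fun s _ => Subalgebra.smul_mem _ (mon_mem_deformedAlg s.1) _⟩,
      Subtype.ext ?_⟩
    change _ * algebraMap (Polynomial ℂ) _ (Polynomial.X - Polynomial.C c) = x
    rw [mul_comm, ← Algebra.smul_def, Finset.smul_sum, ← hg]
    refine Finset.sum_congr rfl fun s hs => ?_
    rw [smul_smul, Polynomial.mul_divByMonic_eq_iff_isRoot.2 (hroot s hs)]
  · rw [Ideal.span_singleton_le_iff_mem, RingHom.mem_ker]
    change specialize k n c (C _) = 0
    simp

theorem range_fiberMap (c : ℂ) :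
    (fiberMap k n c).range =
      (aeval (R := ℂ) fun a : AIdx k n => specialize k n c (deformedMinor a)).range := by
  have h : ∀ f : MvPolynomial (AIdx k n) (Polynomial ℂ),
      specialize k n c (aeval deformedMinor f) =
        aeval (fun a => specialize k n c (deformedMinor a)) (mapAlgHom (Polynomial.aeval c) f) := by
    intro f
    induction f using MvPolynomial.induction_on with
    | C g => simp [algebraMap_eq]
    | add f g hf hg => simp only [map_add, hf, hg]
    | mul_X f a hf => rw [map_mul, map_mul, hf, map_mul, map_mul]; simp
  ext x
  constructor
  · rintro ⟨⟨_, f, rfl⟩, rfl⟩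
    exact ⟨_, (h f).symm⟩
  · rintro ⟨f, rfl⟩
    refine ⟨⟨aeval deformedMinor (mapAlgHom (Algebra.ofId ℂ (Polynomial ℂ)) f), _, rfl⟩, ?_⟩
    have : (mapAlgHom (σ := AIdx k n) (Polynomial.aeval (R := ℂ) c)).comp
        (mapAlgHom (Algebra.ofId ℂ (Polynomial ℂ))) = AlgHom.id ℂ _ := by
      refine algHom_ext fun a => ?_
      simp
    exact (h _).trans (congrArg _ (DFunLike.congr_fun this f))

theorem nonempty_fiberEquiv (hk : 1 ≤ k) (c : ℂ) {x : Polynomial ℂ}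
    (hx : Polynomial.X - Polynomial.C c = x)
    {A : Subalgebra ℂ (MvPolynomial (Fin k × Fin n) ℂ)}
    (hA : (aeval (R := ℂ) fun a : AIdx k n => specialize k n c (deformedMinor a)).range = A) :
    Nonempty ((deformedAlg k n ⧸
      Ideal.span {algebraMap (Polynomial ℂ) (deformedAlg k n) x}) ≃ₐ[ℂ] A) := by
  subst hx hA
  exact ⟨((Ideal.quotientEquivAlgOfEq ℂ (ker_fiberMap hk c).symm).trans
    (Ideal.quotientKerEquivRange (fiberMap k n c))).trans
      (Subalgebra.equivOfEq _ _ (range_fiberMap c))⟩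

theorem range_specialize {c : ℂ} (hc : c ≠ 0) :
    (aeval (R := ℂ) fun a : AIdx k n => specialize k n c (deformedMinor a)).range =
      (pluckerAlg k n).map (rescale k n c) := by
  have h : ∀ a : AIdx k n, rescale k n c (plueckerMinor k n a) =
      c ^ a.diagWeight • specialize k n c (deformedMinor a) := fun a => by
    simpa [mon_single, Finsupp.weight_single] using rescale_mon c (Finsupp.single a 1)
  rw [← Algebra.adjoin_range_eq_range_aeval, pluckerAlg, AlgHom.map_adjoin, ← Set.range_comp]
  apply le_antisymm <;> refine Algebra.adjoin_le ?_ <;> rintro _ ⟨a, rfl⟩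
  · have := Subalgebra.smul_mem _ (Algebra.subset_adjoin (R := ℂ)
      (Set.mem_range_self (f := rescale k n c ∘ plueckerMinor k n) a)) (c ^ a.diagWeight)⁻¹
    rwa [Function.comp_apply, h, inv_smul_smul₀ (pow_ne_zero _ hc)] at this
  · rw [Function.comp_apply, h]
    exact Subalgebra.smul_mem _ (Algebra.subset_adjoin (R := ℂ)
      (Set.mem_range_self (f := fun a : AIdx k n => specialize k n c (deformedMinor a)) a)) _

theorem flat_deformedAlg : Module.Flat (Polynomial ℂ) (deformedAlg k n) := inferInstance

theorem nonempty_flatDegeneration (hk : 1 ≤ k) : Nonempty (FlatDegeneration k n) := by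
  obtain ⟨e⟩ := nonempty_fiberEquiv hk 0 (by rw [map_zero, sub_zero])
    (A := (aeval (R := ℂ) (diagMon (k := k) (n := n))).range)
    (by simp only [specialize_zero_deformedMinor])
  obtain ⟨e'⟩ := nonempty_hibiEquiv (n := n) hk
  exact ⟨{
    S := deformedAlg k n
    algC := inferInstance
    algP := (deformedAlg k n).algebra
    tower := IsScalarTower.of_algebraMap_eq fun _ => rfl
    finiteType := Algebra.FiniteType.of_surjective
      (aeval (R := Polynomial ℂ) deformedMinor).rangeRestrict (AlgHom.rangeRestrict_surjective _)
    flat := flat_deformedAlg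
    specialFiber := e.trans e'
    genericFiber := fun c hc => by
      obtain ⟨e⟩ := nonempty_fiberEquiv (n := n) hk c rfl (range_specialize hc)
      exact ⟨e.trans ((pluckerAlg k n).equivMapOfInjective _ (rescale_injective hc)).symm⟩ }⟩

end Deformation

/-- For `1 ≤ k < n`, the toric variety `P(k,n)` defined by the Hibi binomials is a flat
degeneration of the Plücker-embedded Grassmannian `G(k,n)`: there is a finitely generated
flat `ℂ[t]`-algebra whose fiber at `t = 0` is the Hibi ring `H(k,n)` and whose fiber at
every `t = c ≠ 0` is the Plücker algebra `R(k,n)`. -/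
theorem stmt_4 (k n : ℕ) (hk : 1 ≤ k) (hkn : k < n) :
    Nonempty (FlatDegeneration k n) := by
  exact nonempty_flatDegeneration hk
end

section
/- Let Δ'(2,5) ⊂ ℝ^4 be the convex hull of the seven lattice points e_1 = (1,0,0,0), e_2 = (0,1,0,0), e_3 = (−1,−1,0,0), e_4 = (0,0,1,0), e_5 = (0,0,0,1), e_6 = (0,0,−1,−1), e_7 = (1,1,1,1). Then 0 is an interior point of Δ'(2,5) and every extreme point of the dual polytope { y ∈ ℝ^4 : ⟨x,y⟩ ≥ −1 for all x ∈ Δ'(2,5) } lies in ℤ^4; that is, Δ'(2,5) is a 4-dimensional reflexive polytope. -/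
open Finset

/-- The polytope `Δ'(2,5) ⊂ ℝ⁴`: convex hull of the seven lattice points
`e₁,…,e₇` of the Gorenstein toric Fano variety `P'(2,5)`. -/
noncomputable def deltaP25 : Set (Fin 4 → ℝ) :=
  convexHull ℝ
    {![1, 0, 0, 0], ![0, 1, 0, 0], ![-1, -1, 0, 0], ![0, 0, 1, 0],
      ![0, 0, 0, 1], ![0, 0, -1, -1], ![1, 1, 1, 1]}

/-- The dual polytope `{ y : ⟨x,y⟩ ≥ -1 for all x ∈ Δ'(2,5) }`. -/
noncomputable def deltaP25Dual : Set (Fin 4 → ℝ) :=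
  {y | ∀ x ∈ deltaP25, (∑ i, x i * y i) ≥ -1}

/-- At an extreme point of a set containing every nearby point of the line through it in
direction `v`, the direction `v` vanishes. -/
theorem eq_zero_of_eventually_add_smul_mem {E : Type*} [AddCommGroup E] [Module ℝ E]
    {s : Set E} {y v : E} (hy : y ∈ Set.extremePoints ℝ s)
    (h : ∀ᶠ t : ℝ in nhds 0, y + t • v ∈ s) : v = 0 := by
  obtain ⟨ε, hε, hball⟩ := Metric.eventually_nhds_iff.1 h
  have hmem : ∀ t : ℝ, |t| < ε → y + t • v ∈ s := fun t ht => hball (by simpa using ht)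
  have hpos : y + (ε / 2) • v ∈ s := hmem _ (by rw [abs_of_pos] <;> linarith)
  have hneg : y + (-(ε / 2)) • v ∈ s := hmem _ (by rw [abs_neg, abs_of_pos] <;> linarith)
  have hseg : y ∈ openSegment ℝ (y + (ε / 2) • v) (y + (-(ε / 2)) • v) :=
    ⟨1 / 2, 1 / 2, by norm_num, by norm_num, by norm_num, by module⟩
  have heq : (ε / 2) • v = 0 := by
    simpa using hy.2 hpos hneg hseg
  exact (smul_eq_zero.1 heq).resolve_left (by positivity)

/-- A non-strict affine inequality persists near a parameter value at which it holds, provided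
the slope vanishes whenever the inequality is tight. -/
theorem eventually_le_add_mul {c p q : ℝ} (h : c ≤ p) (htight : p = c → q = 0) :
    ∀ᶠ t : ℝ in nhds 0, c ≤ p + t * q := by
  rcases h.eq_or_lt with h | h
  · simp [htight h.symm, h]
  · have hcont : ContinuousAt (fun t : ℝ => p + t * q) 0 := by fun_prop
    filter_upwards [hcont.eventually_const_lt (by simpa using h)] with t ht using ht.le

theorem mem_deltaP25Dual_iff (y : Fin 4 → ℝ) :
    y ∈ deltaP25Dual ↔ -1 ≤ y 0 ∧ -1 ≤ y 1 ∧ -1 ≤ -(y 0 + y 1) ∧ -1 ≤ y 2 ∧ -1 ≤ y 3 ∧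
      -1 ≤ -(y 2 + y 3) ∧ -1 ≤ y 0 + y 1 + y 2 + y 3 := by
  have hconv : Convex ℝ {x : Fin 4 → ℝ | -1 ≤ ∑ i, x i * y i} := by
    refine convex_halfSpace_ge ⟨fun a b => ?_, fun c a => ?_⟩ _
    · simp [add_mul, Finset.sum_add_distrib]
    · simp [mul_assoc, Finset.mul_sum]
  change deltaP25 ⊆ {x : Fin 4 → ℝ | -1 ≤ ∑ i, x i * y i} ↔ _
  rw [deltaP25, hconv.convexHull_subset_iff]
  simp [Set.insert_subset_iff, Fin.sum_univ_four, add_assoc, add_comm]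

theorem mem_deltaP25_of_abs_lt {x : Fin 4 → ℝ} (hx : ∀ i, |x i| < 1 / 10) : x ∈ deltaP25 := by
  have h i := abs_lt.1 (hx i)
  obtain ⟨h0, h0'⟩ := h 0
  obtain ⟨h1, h1'⟩ := h 1
  obtain ⟨h2, h2'⟩ := h 2
  obtain ⟨h3, h3'⟩ := h 3
  refine mem_convexHull_of_exists_fintype
    ![1 / 6 + (2 * x 0 - x 1) / 3, 1 / 6 + (2 * x 1 - x 0) / 3, 1 / 6 - (x 0 + x 1) / 3,
      1 / 6 + (2 * x 2 - x 3) / 3, 1 / 6 + (2 * x 3 - x 2) / 3, 1 / 6 - (x 2 + x 3) / 3]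
    ![![1, 0, 0, 0], ![0, 1, 0, 0], ![-1, -1, 0, 0], ![0, 0, 1, 0], ![0, 0, 0, 1],
      ![0, 0, -1, -1]] ?_ ?_ ?_ ?_
  · intro i
    fin_cases i <;> simp <;> linarith
  · simp [Fin.sum_univ_six]
    ring
  · intro i
    fin_cases i <;> simp
  · ext i
    fin_cases i <;> simp [Fin.sum_univ_six] <;> ring

theorem zero_mem_interior_deltaP25 : (0 : Fin 4 → ℝ) ∈ interior deltaP25 := by
  refine mem_interior_iff_mem_nhds.2 (Metric.mem_nhds_iff.2 ⟨1 / 10, by norm_num, ?_⟩)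
  intro x hx
  rw [mem_ball_zero_iff] at hx
  exact mem_deltaP25_of_abs_lt fun i => (norm_le_pi_norm x i).trans_lt hx

/-- In the coordinates given by the partial sums of `y`, the facets of the dual polytope bound
differences of two coordinates by integers. Hence a `1`-periodic function of the partial sums is
constant on tight facets, and is constant at an extreme point. -/
theorem periodic_partialSum_eq_of_mem_extremePoints {y : Fin 4 → ℝ}
    (hy : y ∈ Set.extremePoints ℝ deltaP25Dual) {χ : ℝ → ℝ} (hχ : Function.Periodic χ 1) :
    χ (y 0) = χ 0 ∧ χ (y 0 + y 1) = χ 0 ∧ χ (y 0 + y 1 + y 2) = χ 0 ∧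
      χ (y 0 + y 1 + y 2 + y 3) = χ 0 := by
  have hsub : ∀ {a b : ℝ}, a = b - 1 → χ a = χ b := fun h => h ▸ hχ.sub_eq _
  obtain ⟨h1, h2, h3, h4, h5, h6, h7⟩ := (mem_deltaP25Dual_iff y).1 hy.1
  have hv := eq_zero_of_eventually_add_smul_mem
    (v := ![χ (y 0) - χ 0, χ (y 0 + y 1) - χ (y 0), χ (y 0 + y 1 + y 2) - χ (y 0 + y 1),
      χ (y 0 + y 1 + y 2 + y 3) - χ (y 0 + y 1 + y 2)]) hy (by
    filter_upwards [
      eventually_le_add_mul (q := χ (y 0) - χ 0) h1 fun h => by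
        rw [hsub (a := y 0) (b := 0) (by linarith), sub_self],
      eventually_le_add_mul (q := χ (y 0 + y 1) - χ (y 0)) h2 fun h => by
        rw [hsub (a := y 0 + y 1) (b := y 0) (by linarith), sub_self],
      eventually_le_add_mul (q := χ 0 - χ (y 0 + y 1)) h3 fun h => by
        rw [hsub (a := 0) (b := y 0 + y 1) (by linarith), sub_self],
      eventually_le_add_mul (q := χ (y 0 + y 1 + y 2) - χ (y 0 + y 1)) h4 fun h => by
        rw [hsub (a := y 0 + y 1 + y 2) (b := y 0 + y 1) (by linarith), sub_self],
      eventually_le_add_mul (q := χ (y 0 + y 1 + y 2 + y 3) - χ (y 0 + y 1 + y 2)) h5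
        fun h => by
          rw [hsub (a := y 0 + y 1 + y 2 + y 3) (b := y 0 + y 1 + y 2) (by linarith), sub_self],
      eventually_le_add_mul (q := χ (y 0 + y 1) - χ (y 0 + y 1 + y 2 + y 3)) h6 fun h => by
        rw [hsub (a := y 0 + y 1) (b := y 0 + y 1 + y 2 + y 3) (by linarith), sub_self],
      eventually_le_add_mul (q := χ (y 0 + y 1 + y 2 + y 3) - χ 0) h7 fun h => by
        rw [hsub (a := y 0 + y 1 + y 2 + y 3) (b := 0) (by linarith), sub_self]]
      with t h1 h2 h3 h4 h5 h6 h7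
    rw [mem_deltaP25Dual_iff]
    simp only [Pi.add_apply, Pi.smul_apply, smul_eq_mul, Matrix.cons_val]
    refine ⟨?_, ?_, ?_, ?_, ?_, ?_, ?_⟩ <;> linarith)
  have e0 := congrFun hv 0
  have e1 := congrFun hv 1
  have e2 := congrFun hv 2
  have e3 := congrFun hv 3
  simp only [Matrix.cons_val, Pi.zero_apply] at e0 e1 e2 e3
  refine ⟨?_, ?_, ?_, ?_⟩ <;> linarith

/-- `Δ'(2,5)` is a reflexive polytope: `0` is an interior point of `Δ'(2,5)` and every
extreme point of the dual polytope has integer coordinates. -/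
theorem stmt_17 :
    (0 : Fin 4 → ℝ) ∈ interior deltaP25 ∧
      ∀ y ∈ Set.extremePoints ℝ deltaP25Dual, ∀ i : Fin 4, ∃ z : ℤ, y i = (z : ℝ) := by
  refine ⟨zero_mem_interior_deltaP25, fun y hy => ?_⟩
  obtain ⟨h0, h1, h2, h3⟩ :=
    periodic_partialSum_eq_of_mem_extremePoints hy (χ := Int.fract) fun r => Int.fract_add_one r
  rw [Int.fract_zero, Int.fract_eq_zero_iff] at h0 h1 h2 h3
  obtain ⟨a, ha⟩ := h0
  obtain ⟨b, hb⟩ := h1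
  obtain ⟨c, hc⟩ := h2
  obtain ⟨d, hd⟩ := h3
  rw [Fin.forall_fin_succ, Fin.forall_fin_succ, Fin.forall_fin_two]
  refine ⟨⟨a, ha.symm⟩, ⟨b - a, ?_⟩, ⟨c - b, ?_⟩, ⟨d - c, ?_⟩⟩ <;> push_cast <;> linarith
end
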